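/- arXiv:1603.05362 — 3 statements merged into one kernel-verified Lean document; each statement's English description precedes it below -/
import Mathlib

section
/- Fix θ₀ ∈ (0,π/2) and ε > 0. There exists a constant C > 0, depending only on θ₀, ε and Λ, such that for every Dirichlet polynomial p (with exponents in Λ) and every z ∈ S_{ε,θ₀}: |p(z)| ≤ C·e^{−(λ₁·cos θ₀/8)·Re z}·∫₀^∞ |p(t)| dt. -/
/-!
Setting: `Λ = (λ_j)_{j≥0}` is a strictly increasing sequence of positive reals with
`Σ 1/λ_j < ∞`.  A Dirichlet polynomial (with exponents in `Λ`) is a finite sum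
`p(z) = Σ_{j<N} c_j e^{-λ_j z}`.  For `θ₀ ∈ (0,π/2)` and `ε > 0`, the sector is
`S_{ε,θ₀} = {z = x+iy : x ≥ ε, |y| ≤ (x/2)·cot θ₀}`.
-/

open MeasureTheory Set
open scoped ENNReal

noncomputable section

namespace DirichletBBP

/-- `p` is a Dirichlet polynomial with exponents in `Λ`. -/
def IsDirichletPoly (Λ : ℕ → ℝ) (p : ℂ → ℂ) : Prop :=
  ∃ (N : ℕ) (c : Fin N → ℂ),
    p = fun z => ∑ j : Fin N, c j * Complex.exp (-(Λ j : ℂ) * z)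

/-- Membership in the sector `S_{ε,θ₀}`. -/
def InSector (ε θ₀ : ℝ) (z : ℂ) : Prop :=
  ε ≤ z.re ∧ |z.im| ≤ z.re / 2 * (Real.cos θ₀ / Real.sin θ₀)

/-- A finite product `∏ (1 + k R / Λ j)` grows subexponentially in `R`, uniformly in the product. -/
lemma exists_prod_one_add_le {Λ : ℕ → ℝ} (hpos : ∀ j, 0 < Λ j)
    (hsum : Summable fun j => 1 / Λ j) {k δ : ℝ} (hk : 0 < k) (hδ : 0 < δ) :
    ∃ C : ℝ, 0 < C ∧ ∀ (s : Finset ℕ) (R : ℝ), 0 ≤ R →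
      ∏ j ∈ s, (1 + k * R / Λ j) ≤ C * Real.exp (δ * R) := by
  obtain ⟨M, hM⟩ := summable_iff_vanishing_norm.1 hsum (δ / (2 * k)) (by positivity)
  have hS : 0 ≤ ∑' j, 1 / Λ j := tsum_nonneg fun j => (one_div_pos.2 (hpos j)).le
  set S := ∑' j, 1 / Λ j
  set η := min 1 (δ / (2 * k * (S + 1)))
  have hη : 0 < η := lt_min one_pos (by positivity)
  have hη1 : η ≤ 1 := min_le_left _ _
  have hηS : η * k * S ≤ δ / 2 := by
    have h : η * (2 * k * (S + 1)) ≤ δ := (le_div_iff₀ (by positivity)).1 (min_le_right _ _)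
    nlinarith [mul_pos hη hk]
  refine ⟨η⁻¹ ^ M.card, by positivity, fun s R hR => ?_⟩
  have hfac : ∀ j, 0 ≤ k * R / Λ j := fun j => by have := hpos j; positivity
  have h1 : ∏ j ∈ s ∩ M, (1 + k * R / Λ j) ≤ η⁻¹ ^ M.card * Real.exp (δ / 2 * R) := by
    calc ∏ j ∈ s ∩ M, (1 + k * R / Λ j)
        ≤ ∏ j ∈ s ∩ M, (η⁻¹ * Real.exp (η * (k * R / Λ j))) := by
          refine Finset.prod_le_prod (fun j _ => by linarith [hfac j]) fun j _ => ?_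
          rw [inv_mul_eq_div, le_div_iff₀ hη]
          nlinarith [Real.add_one_le_exp (η * (k * R / Λ j))]
      _ = η⁻¹ ^ (s ∩ M).card * Real.exp (η * k * R * ∑ j ∈ s ∩ M, 1 / Λ j) := by
          rw [Finset.prod_mul_distrib, Finset.prod_const, ← Real.exp_sum, Finset.mul_sum]
          congr 2
          exact Finset.sum_congr rfl fun j _ => by ring
      _ ≤ _ := by
          refine mul_le_mul (pow_le_pow_right₀ ?_ (Finset.card_le_card ?_)) (Real.exp_le_exp.2 ?_)
            (Real.exp_pos _).le (by positivity)
          · exact one_le_inv_iff₀.2 ⟨hη, hη1⟩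
          · exact Finset.inter_subset_right
          · have : ∑ j ∈ s ∩ M, 1 / Λ j ≤ S :=
              hsum.sum_le_tsum _ fun j _ => (one_div_pos.2 (hpos j)).le
            calc η * k * R * ∑ j ∈ s ∩ M, 1 / Λ j ≤ η * k * R * S := by gcongr
              _ = η * k * S * R := by ring
              _ ≤ _ := by gcongr
  have h2 : ∏ j ∈ s \ M, (1 + k * R / Λ j) ≤ Real.exp (δ / 2 * R) := by
    refine (Real.prod_one_add_le_exp_sum _ hfac).trans (Real.exp_le_exp.2 ?_)
    have h := (le_abs_self _).trans (hM (s \ M) Finset.sdiff_disjoint).le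
    calc ∑ j ∈ s \ M, k * R / Λ j = k * R * ∑ j ∈ s \ M, 1 / Λ j := by
          rw [Finset.mul_sum]; exact Finset.sum_congr rfl fun j _ => by ring
      _ ≤ k * R * (δ / (2 * k)) := by gcongr
      _ = _ := by field_simp
  calc ∏ j ∈ s, (1 + k * R / Λ j)
      = (∏ j ∈ s ∩ M, (1 + k * R / Λ j)) * ∏ j ∈ s \ M, (1 + k * R / Λ j) :=
        (Finset.prod_inter_mul_prod_sdiff s M _).symm
    _ ≤ (η⁻¹ ^ M.card * Real.exp (δ / 2 * R)) * Real.exp (δ / 2 * R) :=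
        mul_le_mul h1 h2 (Finset.prod_nonneg fun j _ => by linarith [hfac j]) (by positivity)
    _ = _ := by rw [mul_assoc, ← Real.exp_add]; ring_nf

lemma hasDerivAt_exp_div_sub (μ z : ℂ) : ∃ H : ℂ → ℂ, ∀ ζ, ζ ≠ μ →
    HasDerivAt H ((Complex.exp (-ζ * z) - Complex.exp (-μ * z)) / (ζ - μ)) ζ := by
  have hd : Differentiable ℂ (dslope (fun ζ => Complex.exp (-ζ * z)) μ) := by
    rw [← differentiableOn_univ, Complex.differentiableOn_dslope Filter.univ_mem]
    fun_prop
  obtain ⟨H, hH⟩ := hd.isExactOn_univ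
  refine ⟨H, fun ζ hζ => ?_⟩
  have := hH ζ (mem_univ ζ)
  rwa [dslope_of_ne _ hζ, slope_def_field] at this

lemma integral_segment_eq_sub {Φ g : ℂ → ℂ} {A D : ℂ} {a b : ℝ}
    (hΦ : ∀ t ∈ uIcc a b, HasDerivAt Φ (g (A + t * D)) (A + t * D))
    (hg : ∀ t ∈ uIcc a b, ContinuousAt g (A + t * D)) :
    ∫ t in a..b, D * g (A + t * D) = Φ (A + b * D) - Φ (A + a * D) := by
  have hline : ∀ t : ℝ, HasDerivAt (fun t : ℝ => A + (t : ℂ) * D) D t := fun t => by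
    simpa using ((Complex.ofRealCLM.hasDerivAt (x := t)).mul_const D).const_add A
  refine intervalIntegral.integral_eq_sub_of_hasDerivAt
    (f := fun t : ℝ => Φ (A + t * D)) (fun t ht => ?_) ?_
  · rw [mul_comm]
    exact (hΦ t ht).comp t (hline t)
  · refine ContinuousOn.intervalIntegrable fun t ht => ContinuousAt.continuousWithinAt ?_
    exact continuousAt_const.mul
      (ContinuousAt.comp (f := fun t : ℝ => A + (t : ℂ) * D) (hg t ht) (hline t).continuousAt)

lemma log_neg_of_im_pos {x : ℂ} (h : 0 < x.im) :
    Complex.log (-x) = Complex.log x - Real.pi * Complex.I := by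
  simp only [Complex.log, norm_neg, Complex.arg_neg_eq_arg_sub_pi_of_im_pos h]
  push_cast; ring

lemma log_neg_of_im_neg {x : ℂ} (h : x.im < 0) :
    Complex.log (-x) = Complex.log x + Real.pi * Complex.I := by
  simp only [Complex.log, norm_neg, Complex.arg_neg_eq_arg_add_pi_of_im_neg h]
  push_cast; ring

lemma re_mul_ge (r c s : ℝ) (z : ℂ) {t : ℝ} (ht : |t| ≤ s * r) :
    r * (z.re * c - |z.im| * s) ≤ (((r * c : ℝ) + t * Complex.I : ℂ) * z).re := by
  have : t * z.im ≤ s * r * |z.im| := by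
    calc t * z.im ≤ |t * z.im| := le_abs_self _
      _ = |t| * |z.im| := abs_mul _ _
      _ ≤ _ := by gcongr
  simp
  nlinarith

/-- The inverse Laplace transform of `1 / (ζ - μ)` along the boundary of a sector. -/
lemma tendsto_sector_integral {μ c s : ℝ} (hμ : 0 < μ) (hc : 0 < c) (hs : 0 < s) {z : ℂ}
    (hz : 0 < z.re * c - |z.im| * s) :
    Filter.Tendsto (fun R : ℝ =>
      (∫ r in (0 : ℝ)..R, (c + s * Complex.I) *
        (Complex.exp (-(r * (c + s * Complex.I)) * z) / (r * (c + s * Complex.I) - μ))) -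
      ∫ r in (0 : ℝ)..R, (c + (-s : ℝ) * Complex.I) *
        (Complex.exp (-(r * (c + (-s : ℝ) * Complex.I)) * z) / (r * (c + (-s : ℝ) * Complex.I) - μ)))
      Filter.atTop (nhds (-(2 * Real.pi * Complex.I) * Complex.exp (-μ * z))) := by
  set κ := z.re * c - |z.im| * s
  obtain ⟨H, hH⟩ := hasDerivAt_exp_div_sub μ z
  set e := Complex.exp (-μ * z)
  set g : ℂ → ℂ := fun ζ => Complex.exp (-ζ * z) / (ζ - μ)
  have hg : ∀ ζ : ℂ, ζ ≠ μ → ContinuousAt g ζ := fun ζ hζ =>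
    ContinuousAt.div (by fun_prop) (by fun_prop) (sub_ne_zero.2 hζ)
  have hΦ : ∀ ζ : ℂ, ↑μ - ζ ∈ Complex.slitPlane →
      HasDerivAt (fun ζ => H ζ + e * Complex.log (μ - ζ)) (g ζ) ζ := fun ζ hζ => by
    have h0 : (μ : ℂ) - ζ ≠ 0 := Complex.slitPlane_ne_zero hζ
    have h1 : ζ - μ ≠ 0 := by rwa [← neg_sub, neg_ne_zero]
    refine ((hH ζ (sub_ne_zero.1 h1)).add
      ((((hasDerivAt_id ζ).const_sub (μ : ℂ)).clog hζ).const_mul e)).congr_deriv ?_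
    simp only [g, id]
    field_simp
    ring
  have hΨ : ∀ ζ : ℂ, ζ - ↑μ ∈ Complex.slitPlane →
      HasDerivAt (fun ζ => H ζ + e * Complex.log (ζ - μ)) (g ζ) ζ := fun ζ hζ => by
    have h1 : ζ - μ ≠ 0 := Complex.slitPlane_ne_zero hζ
    refine ((hH ζ (sub_ne_zero.1 h1)).add
      ((((hasDerivAt_id ζ).sub_const (μ : ℂ)).clog hζ).const_mul e)).congr_deriv ?_
    simp only [g, id]
    field_simp
    ring
  have hray : ∀ σ : ℝ, σ ≠ 0 → ∀ R : ℝ, 0 ≤ R →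
      ∫ r in (0 : ℝ)..R, (c + σ * Complex.I) *
        (Complex.exp (-(r * (c + σ * Complex.I)) * z) / (r * (c + σ * Complex.I) - μ)) =
      (H (R * (c + σ * Complex.I)) + e * Complex.log (μ - R * (c + σ * Complex.I))) -
        (H 0 + e * Complex.log μ) := fun σ hσ R hR => by
    have hsl : ∀ r : ℝ, 0 ≤ r → (μ : ℂ) - (0 + r * (c + σ * Complex.I)) ∈ Complex.slitPlane := by
      intro r hr
      rw [Complex.mem_slitPlane_iff]
      rcases hr.eq_or_lt with rfl | hr
      · left; simpa
      · right; simp [hr.ne', hσ]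
    have := integral_segment_eq_sub (A := 0) (D := c + σ * Complex.I) (a := 0) (b := R)
      (Φ := fun ζ => H ζ + e * Complex.log (μ - ζ)) (g := g)
      (fun r hr => hΦ _ (hsl r (by rw [uIcc_of_le hR] at hr; exact hr.1)))
      (fun r hr => hg _ fun h => Complex.slitPlane_ne_zero
        (hsl r (by rw [uIcc_of_le hR] at hr; exact hr.1)) (by rw [h, sub_self]))
    simpa [g] using this
  have hev : ∀ᶠ R : ℝ in Filter.atTop, 0 ≤ R ∧ μ + 1 ≤ R * c :=
    (Filter.eventually_ge_atTop 0).and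
      ((Filter.tendsto_id.atTop_mul_const hc).eventually_ge_atTop (μ + 1))
  rw [tendsto_iff_norm_sub_tendsto_zero]
  have hlim : Filter.Tendsto (fun R : ℝ => 2 * s * (R * Real.exp (-κ * R))) Filter.atTop
      (nhds 0) := by
    have := tendsto_rpow_mul_exp_neg_mul_atTop_nhds_zero 1 κ hz
    simpa using this.const_mul (2 * s)
  refine squeeze_zero' (Filter.Eventually.of_forall fun _ => norm_nonneg _) ?_ hlim
  filter_upwards [hev] with R ⟨hR, hRc⟩
  have hR0 : 0 < R := by
    rcases hR.eq_or_lt with rfl | h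
    · linarith
    · exact h
  rw [hray s hs.ne' R hR, hray (-s) (neg_ne_zero.2 hs.ne') R hR]
  have hchord := integral_segment_eq_sub (A := (R * c : ℝ)) (D := Complex.I) (a := -(s * R))
    (b := s * R) (Φ := fun ζ => H ζ + e * Complex.log (ζ - μ)) (g := g)
    (fun t _ => hΨ _ (by rw [Complex.mem_slitPlane_iff]; left; simp; linarith))
    (fun t _ => hg _ fun h => by
      have := congrArg Complex.re h
      simp at this
      linarith)
  have hp : (R * (c + s * Complex.I) : ℂ) = (R * c : ℝ) + (s * R : ℝ) * Complex.I := by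
    push_cast; ring
  have hm : (R * (c + (-s : ℝ) * Complex.I) : ℂ) =
      (R * c : ℝ) + (-(s * R) : ℝ) * Complex.I := by
    push_cast; ring
  rw [← hp, ← hm] at hchord
  have hlp := log_neg_of_im_pos (x := (R * (c + s * Complex.I) : ℂ) - μ) (by simp; positivity)
  have hlm := log_neg_of_im_neg (x := (R * (c + (-s : ℝ) * Complex.I) : ℂ) - μ)
    (by simp; positivity)
  rw [neg_sub] at hlp hlm
  have hbound : ‖∫ t in (-(s * R))..(s * R), Complex.I * g ((R * c : ℝ) + t * Complex.I)‖ ≤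
      Real.exp (-κ * R) * |s * R - -(s * R)| := by
    refine intervalIntegral.norm_integral_le_of_norm_le_const fun t ht => ?_
    have ht' : |t| ≤ s * R := by
      rw [uIoc_of_le (by nlinarith)] at ht
      exact abs_le.2 ⟨ht.1.le, ht.2⟩
    have h1 : 1 ≤ ‖((R * c : ℝ) + t * Complex.I : ℂ) - μ‖ := by
      refine le_trans ?_ ((le_abs_self _).trans (Complex.abs_re_le_norm _))
      simp; linarith
    have h2 := re_mul_ge R c s z ht'
    simp only [g, norm_mul, Complex.norm_I, one_mul, norm_div, Complex.norm_exp]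
    refine (div_le_self (Real.exp_pos _).le h1).trans (Real.exp_le_exp.2 ?_)
    rw [neg_mul, Complex.neg_re]
    linarith
  rw [abs_of_nonneg (by nlinarith)] at hbound
  calc _ = ‖∫ t in (-(s * R))..(s * R), Complex.I * g ((R * c : ℝ) + t * Complex.I)‖ := by
        rw [hchord, hlp, hlm]; congr 1; ring
    _ ≤ _ := hbound
    _ = _ := by ring

section ExponentialSums

variable {ι : Type*} [Fintype ι]

lemma integrableOn_exp_sum {l : ι → ℝ} (hl : ∀ j, 0 < l j) (c : ι → ℂ) :
    IntegrableOn (fun t : ℝ => ∑ j, c j * Complex.exp (-(l j : ℂ) * t)) (Ioi 0) :=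
  integrable_finsetSum _ fun j _ =>
    (integrableOn_exp_mul_complex_Ioi (by simpa using hl j) 0).const_mul (c j)

/-- The Laplace transform of an exponential sum, on the imaginary axis. -/
lemma norm_sum_div_sub_mul_I_le {l : ι → ℝ} (hl : ∀ j, 0 < l j) (c : ι → ℂ) (τ : ℝ) :
    ‖∑ j, c j / (l j - τ * Complex.I)‖ ≤
      ∫ t in Ioi (0 : ℝ), ‖∑ j, c j * Complex.exp (-(l j : ℂ) * t)‖ := by
  have hre : ∀ j, (-(l j : ℂ) + τ * Complex.I).re < 0 := fun j => by simpa using hl j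
  have h : ∑ j, c j / (l j - τ * Complex.I) =
      ∫ t in Ioi (0 : ℝ), (∑ j, c j * Complex.exp (-(l j : ℂ) * t)) *
        Complex.exp ((τ * t : ℝ) * Complex.I) := by
    calc _ = ∑ j, ∫ t in Ioi (0 : ℝ), c j * Complex.exp ((-(l j : ℂ) + τ * Complex.I) * t) := by
          refine Finset.sum_congr rfl fun j _ => ?_
          rw [integral_const_mul, integral_exp_mul_complex_Ioi (hre j)]
          rw [Complex.ofReal_zero, mul_zero, Complex.exp_zero, neg_div, ← div_neg, neg_add, neg_neg,
            ← sub_eq_add_neg, mul_one_div]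
      _ = ∫ t in Ioi (0 : ℝ), ∑ j, c j * Complex.exp ((-(l j : ℂ) + τ * Complex.I) * t) :=
          (integral_finsetSum _ fun j _ =>
            (integrableOn_exp_mul_complex_Ioi (hre j) 0).const_mul (c j)).symm
      _ = _ := by
          congr 1; ext t
          rw [Finset.sum_mul]
          refine Finset.sum_congr rfl fun j _ => ?_
          rw [mul_assoc, ← Complex.exp_add]
          congr 2; push_cast; ring
  rw [h]
  refine (norm_integral_le_integral_norm _).trans_eq ?_
  congr 1; ext t
  rw [norm_mul, Complex.norm_exp_ofReal_mul_I, mul_one]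

lemma ofReal_add_ne_zero {l : ℝ} (hl : 0 < l) {ζ : ℂ} (hζ : 0 ≤ ζ.re) : (l : ℂ) + ζ ≠ 0 := by
  intro h
  have := congrArg Complex.re h
  simp at this
  linarith

/-- The Laplace transform of an exponential sum, continued to the left half-plane and divided by
its Blaschke product. -/
lemma norm_sum_div_sub_le {l : ι → ℝ} (hl : ∀ j, 0 < l j) (c : ι → ℂ) {ζ : ℂ} (hζ : 0 ≤ ζ.re)
    (hne : ∀ j, ζ ≠ l j) :
    ‖∑ j, c j / (l j - ζ)‖ ≤ (∏ j, ‖(l j : ℂ) + ζ‖ / ‖(l j : ℂ) - ζ‖) *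
      ∫ t in Ioi (0 : ℝ), ‖∑ j, c j * Complex.exp (-(l j : ℂ) * t)‖ := by
  classical
  set G : ℂ → ℂ := fun ζ => ∑ k, c k / (l k + ζ) *
    ∏ j ∈ Finset.univ.erase k, ((l j - ζ) / (l j + ζ)) with hG
  have hfactor : ∀ ξ : ℂ, 0 ≤ ξ.re → (∀ j, ξ ≠ l j) →
      G ξ = (∏ j, ((l j - ξ) / (l j + ξ))) * ∑ k, c k / (l k - ξ) := fun ξ hξ hξne => by
    rw [Finset.mul_sum]
    refine Finset.sum_congr rfl fun k _ => ?_
    rw [← Finset.mul_prod_erase _ _ (Finset.mem_univ k)]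
    have h1 : (l k : ℂ) - ξ ≠ 0 := sub_ne_zero.2 (hξne k).symm
    have h2 := ofReal_add_ne_zero (hl k) hξ
    field_simp
  have hle : ∀ (j) (ξ : ℂ), 0 ≤ ξ.re → ‖((l j : ℂ) - ξ) / (l j + ξ)‖ ≤ 1 := fun j ξ hξ => by
    rw [norm_div]
    refine div_le_one_of_le₀ ?_ (norm_nonneg _)
    rw [← sq_le_sq₀ (norm_nonneg _) (norm_nonneg _), ← Complex.normSq_eq_norm_sq,
      ← Complex.normSq_eq_norm_sq, Complex.normSq_apply, Complex.normSq_apply]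
    simp
    nlinarith [mul_nonneg (hl j).le hξ]
  have hprod : ∀ (k) (ξ : ℂ), 0 ≤ ξ.re →
      ‖∏ j ∈ Finset.univ.erase k, (((l j : ℂ) - ξ) / (l j + ξ))‖ ≤ 1 := fun k ξ hξ => by
    rw [norm_prod]
    exact Finset.prod_le_one (fun _ _ => norm_nonneg _) fun j _ => hle j ξ hξ
  have hGle : ∀ ξ : ℂ, 0 ≤ ξ.re → ‖G ξ‖ ≤ ∑ k, ‖c k‖ / ‖(l k : ℂ) + ξ‖ := fun ξ hξ => by
    refine (norm_sum_le _ _).trans (Finset.sum_le_sum fun k _ => ?_)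
    rw [norm_mul, norm_div]
    exact mul_le_of_le_one_right (by positivity) (hprod k ξ hξ)
  have hre_le : ∀ (k) (ξ : ℂ), l k + ξ.re ≤ ‖(l k : ℂ) + ξ‖ := fun k ξ => by
    simpa using Complex.re_le_norm ((l k : ℂ) + ξ)
  have hdiff : DifferentiableOn ℂ G {ξ | ∀ j, (l j : ℂ) + ξ ≠ 0} := fun ξ hξ => by
    refine DifferentiableAt.differentiableWithinAt (DifferentiableAt.fun_sum fun k _ => ?_)
    refine DifferentiableAt.mul (DifferentiableAt.div (by fun_prop) (by fun_prop) (hξ k)) ?_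
    refine DifferentiableAt.fun_finsetProd fun j _ => ?_
    exact DifferentiableAt.div (by fun_prop) (by fun_prop) (hξ j)
  have hGζ : ‖G ζ‖ ≤ ∫ t in Ioi (0 : ℝ), ‖∑ j, c j * Complex.exp (-(l j : ℂ) * t)‖ := by
    refine PhragmenLindelof.right_half_plane_of_tendsto_zero_on_real (f := G) ?_ ?_ ?_ ?_ hζ
    · refine DifferentiableOn.diffContOnCl (hdiff.mono ?_)
      rw [Complex.closure_setOfPred_lt_re]
      exact fun ξ hξ j => ofReal_add_ne_zero (hl j) hξ
    · refine ⟨0, two_pos, 0, Asymptotics.IsBigO.of_bound (∑ k, ‖c k‖ / l k) ?_⟩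
      refine Filter.eventually_inf_principal.2 (Filter.Eventually.of_forall fun ξ hξ => ?_)
      have hξ' : 0 < ξ.re := hξ
      simp only [zero_mul, Real.exp_zero, norm_one, mul_one]
      refine (hGle ξ hξ'.le).trans (Finset.sum_le_sum fun k _ => ?_)
      gcongr
      · exact hl k
      · linarith [hre_le k ξ]
    · refine squeeze_zero_norm' (a := fun x : ℝ => ∑ k, ‖c k‖ / (l k + x)) ?_ ?_
      · filter_upwards [Filter.eventually_ge_atTop 0] with x hx
        refine (hGle x (by simpa)).trans (Finset.sum_le_sum fun k _ => ?_)
        gcongr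
        · linarith [hl k]
        · simpa using hre_le k x
      · rw [← Finset.sum_const_zero (s := (Finset.univ : Finset ι))]
        refine tendsto_finsetSum _ fun k _ => ?_
        exact tendsto_const_nhds.div_atTop (Filter.tendsto_atTop_add_const_left _ _ Filter.tendsto_id)
    · intro x
      have hx : ∀ j, (x * Complex.I : ℂ) ≠ l j := fun j h => by
        have := congrArg Complex.re h
        simp at this
        linarith [hl j]
      rw [hfactor _ (by simp) hx, norm_mul]
      refine (mul_le_of_le_one_left (norm_nonneg _) ?_).trans (norm_sum_div_sub_mul_I_le hl c x)
      rw [norm_prod]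
      exact Finset.prod_le_one (fun _ _ => norm_nonneg _) fun j _ => hle j _ (by simp)
  rw [hfactor ζ hζ hne, norm_mul, norm_prod] at hGζ
  have hnz : ∀ j, 0 < ‖(l j : ℂ) - ζ‖ := fun j => norm_pos_iff.2 (sub_ne_zero.2 (hne j).symm)
  have hnz' : ∀ j, 0 < ‖(l j : ℂ) + ζ‖ := fun j => norm_pos_iff.2 (ofReal_add_ne_zero (hl j) hζ)
  have hinv : ∏ j, ‖(l j : ℂ) + ζ‖ / ‖(l j : ℂ) - ζ‖ =
      (∏ j, ‖((l j : ℂ) - ζ) / (l j + ζ)‖)⁻¹ := by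
    rw [← Finset.prod_inv_distrib]
    exact Finset.prod_congr rfl fun j _ => by rw [norm_div, inv_div]
  have hpp : 0 < ∏ j, ‖((l j : ℂ) - ζ) / (l j + ζ)‖ :=
    Finset.prod_pos fun j _ => by rw [norm_div]; exact div_pos (hnz j) (hnz' j)
  rw [hinv, inv_mul_eq_div, le_div_iff₀ hpp, mul_comm]
  exact hGζ

/-- On the rays `a + r e^{±iθ}` the reciprocal Blaschke factor for `l ≥ 2 a` grows at most
linearly. -/
lemma norm_add_div_norm_sub_le {l a r c s : ℝ} (ha : 0 < a) (hal : 2 * a ≤ l) (hr : 0 ≤ r)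
    (hs : s ≠ 0) (hcs : s ^ 2 + c ^ 2 = 1) :
    (l : ℂ) - (a + r * (c + s * Complex.I)) ≠ 0 ∧
    ‖(l : ℂ) + (a + r * (c + s * Complex.I))‖ / ‖(l : ℂ) - (a + r * (c + s * Complex.I))‖ ≤
      1 + 4 / |s| * (a + r) / l := by
  have hl : 0 < l := by linarith
  have hs' : 0 < |s| := abs_pos.2 hs
  set ζ : ℂ := a + r * (c + s * Complex.I) with hζ
  have hlow : l / 2 * |s| ≤ ‖(l : ℂ) - ζ‖ := by
    rw [← sq_le_sq₀ (by positivity) (norm_nonneg _), ← Complex.normSq_eq_norm_sq,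
      Complex.normSq_apply, mul_pow, sq_abs]
    simp only [hζ, Complex.sub_re, Complex.add_re, Complex.mul_re, Complex.ofReal_re,
      Complex.ofReal_im, Complex.I_re, Complex.I_im, Complex.sub_im, Complex.add_im,
      Complex.mul_im]
    have h1 : (l / 2) ^ 2 * s ^ 2 ≤ (l - a) ^ 2 * s ^ 2 := by gcongr; linarith
    have h2 : (l - a - r * c) ^ 2 + (r * s) ^ 2 = (r - (l - a) * c) ^ 2 + (l - a) ^ 2 * s ^ 2 := by
      linear_combination (r ^ 2 - (l - a) ^ 2) * hcs
    nlinarith [sq_nonneg (r - (l - a) * c)]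
  have hpos : 0 < ‖(l : ℂ) - ζ‖ := lt_of_lt_of_le (by positivity) hlow
  have hw : ‖(c + s * Complex.I : ℂ)‖ = 1 := by
    rw [← sq_eq_sq₀ (norm_nonneg _) zero_le_one, ← Complex.normSq_eq_norm_sq,
      Complex.normSq_add_mul_I]
    linarith
  have hup : ‖ζ‖ ≤ a + r := by
    refine (norm_add_le _ _).trans_eq ?_
    rw [norm_mul, hw, mul_one, Complex.norm_of_nonneg ha.le, Complex.norm_of_nonneg hr]
  refine ⟨norm_pos_iff.1 hpos, ?_⟩
  have htri : ‖(l : ℂ) + ζ‖ ≤ ‖(l : ℂ) - ζ‖ + 2 * (a + r) := by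
    calc ‖(l : ℂ) + ζ‖ = ‖((l : ℂ) - ζ) + 2 * ζ‖ := by congr 1; ring
      _ ≤ ‖(l : ℂ) - ζ‖ + ‖2 * ζ‖ := norm_add_le _ _
      _ = ‖(l : ℂ) - ζ‖ + 2 * ‖ζ‖ := by simp
      _ ≤ _ := by gcongr
  calc _ ≤ (‖(l : ℂ) - ζ‖ + 2 * (a + r)) / ‖(l : ℂ) - ζ‖ := by gcongr
    _ = 1 + 2 * (a + r) / ‖(l : ℂ) - ζ‖ := by rw [add_div, div_self hpos.ne']
    _ ≤ 1 + 2 * (a + r) / (l / 2 * |s|) := by gcongr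
    _ = _ := by field_simp; ring

lemma integral_exp_neg_mul_le {κ R : ℝ} (hκ : 0 < κ) :
    ∫ r in (0 : ℝ)..R, Real.exp (-κ * r) ≤ 1 / κ := by
  rw [intervalIntegral.integral_comp_mul_left (fun x => Real.exp x) (neg_ne_zero.2 hκ.ne'),
    integral_exp, mul_zero, Real.exp_zero, smul_eq_mul, one_div, inv_neg, neg_mul, ← mul_neg,
    neg_sub]
  exact mul_le_of_le_one_right (by positivity) (by linarith [Real.exp_pos (-κ * R)])

/-- The truncated ray integral representing an exponential sum. -/
lemma norm_ray_integral_le {l : ι → ℝ} {a c s : ℝ} (ha : 0 < a) (hal : ∀ j, 2 * a ≤ l j)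
    (hc : 0 ≤ c) (hs : s ≠ 0) (hcs : s ^ 2 + c ^ 2 = 1) (b : ι → ℂ) {C κ : ℝ} (hκ : 0 < κ)
    (hC : ∀ R : ℝ, 0 ≤ R → ∏ j, (1 + 4 / |s| * R / l j) ≤ C * Real.exp (κ * R)) {z : ℂ}
    (hz : 2 * κ ≤ z.re * c - |z.im| * |s|) {R : ℝ} (hR : 0 ≤ R) :
    ‖∑ j, b j * Complex.exp (-a * z) * ∫ r in (0 : ℝ)..R, (c + s * Complex.I) *
      (Complex.exp (-(r * (c + s * Complex.I)) * z) /
        (r * (c + s * Complex.I) - ((l j - a : ℝ) : ℂ)))‖ ≤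
      C * Real.exp (κ * a) / κ * Real.exp (-a * z.re) *
        ∫ t in Ioi (0 : ℝ), ‖∑ j, b j * Complex.exp (-(l j : ℂ) * t)‖ := by
  have hl : ∀ j, 0 < l j := fun j => by linarith [hal j]
  set I := ∫ t in Ioi (0 : ℝ), ‖∑ j, b j * Complex.exp (-(l j : ℂ) * t)‖
  have hI : 0 ≤ I := integral_nonneg fun t => norm_nonneg _
  have hC0 : 0 ≤ C := by
    have := hC 0 le_rfl
    simp at this
    linarith
  set w : ℂ := c + s * Complex.I with hwdef
  have hw : ‖w‖ = 1 := by
    rw [← sq_eq_sq₀ (norm_nonneg _) zero_le_one, ← Complex.normSq_eq_norm_sq,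
      Complex.normSq_add_mul_I]
    linarith
  have hne : ∀ (j) (r : ℝ), 0 ≤ r → (l j : ℂ) - (a + r * w) ≠ 0 := fun j r hr =>
    (norm_add_div_norm_sub_le ha (hal j) hr hs hcs).1
  have hsum : ∑ j, b j * Complex.exp (-a * z) * ∫ r in (0 : ℝ)..R, w *
      (Complex.exp (-(r * w) * z) / (r * w - ((l j - a : ℝ) : ℂ))) =
      ∫ r in (0 : ℝ)..R, -(w * Complex.exp (-a * z) * Complex.exp (-(r * w) * z)) *
        ∑ j, b j / (l j - (a + r * w)) := by
    simp_rw [← intervalIntegral.integral_const_mul]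
    rw [← intervalIntegral.integral_finsetSum]
    · refine intervalIntegral.integral_congr fun r hr => ?_
      rw [uIcc_of_le hR] at hr
      simp only [Finset.mul_sum]
      refine Finset.sum_congr rfl fun j _ => ?_
      have h1 := hne j r hr.1
      have h2 : (r * w - ((l j - a : ℝ) : ℂ)) = -((l j : ℂ) - (a + r * w)) := by push_cast; ring
      rw [h2]
      field_simp
    · intro j _
      refine ContinuousOn.intervalIntegrable fun r hr => ContinuousAt.continuousWithinAt ?_
      rw [uIcc_of_le hR] at hr
      refine continuousAt_const.mul (continuousAt_const.mul
        (ContinuousAt.div (by fun_prop) (by fun_prop) fun h => hne j r hr.1 ?_))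
      push_cast at h
      linear_combination -h
  rw [hsum]
  have hbound : ∀ r : ℝ, 0 ≤ r →
      ‖-(w * Complex.exp (-a * z) * Complex.exp (-(r * w) * z)) *
        ∑ j, b j / (l j - (a + r * w))‖ ≤
      C * Real.exp (κ * a) * Real.exp (-a * z.re) * I * Real.exp (-κ * r) := fun r hr => by
    have hre : 0 ≤ (a + r * w : ℂ).re := by
      simp [hwdef]; positivity
    have h1 := norm_sum_div_sub_le hl b hre fun j h => hne j r hr (by rw [h, sub_self])
    have h2 : ∏ j, ‖(l j : ℂ) + (a + r * w)‖ / ‖(l j : ℂ) - (a + r * w)‖ ≤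
        C * Real.exp (κ * (a + r)) :=
      (Finset.prod_le_prod (fun j _ => by positivity) fun j _ =>
        (norm_add_div_norm_sub_le ha (hal j) hr hs hcs).2).trans (hC _ (by positivity))
    have h3 : ‖Complex.exp (-(r * w) * z)‖ ≤ Real.exp (-(2 * κ) * r) := by
      rw [Complex.norm_exp, neg_mul, Complex.neg_re]
      refine Real.exp_le_exp.2 ?_
      have : s * z.im ≤ |z.im| * |s| := by
        rw [mul_comm, ← abs_mul]; exact le_abs_self _
      have h4 : (r * w * z).re = r * (z.re * c - s * z.im) := by
        simp [hwdef]; ring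
      rw [h4]
      nlinarith
    have h5 : ‖Complex.exp (-a * z)‖ = Real.exp (-a * z.re) := by
      rw [Complex.norm_exp]; simp
    rw [norm_mul, norm_neg, norm_mul, norm_mul, hw, one_mul, h5]
    calc _ ≤ Real.exp (-a * z.re) * Real.exp (-(2 * κ) * r) *
          (C * Real.exp (κ * (a + r)) * I) := by
          gcongr
          exact h1.trans (by gcongr)
      _ = C * (Real.exp (κ * (a + r)) * Real.exp (-(2 * κ) * r)) * Real.exp (-a * z.re) * I := by
          ring
      _ = C * (Real.exp (κ * a) * Real.exp (-κ * r)) * Real.exp (-a * z.re) * I := by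
          rw [← Real.exp_add, ← Real.exp_add]; ring_nf
      _ = _ := by ring
  calc _ ≤ ∫ r in (0 : ℝ)..R,
        C * Real.exp (κ * a) * Real.exp (-a * z.re) * I * Real.exp (-κ * r) :=
        intervalIntegral.norm_integral_le_of_norm_le hR
          (Filter.Eventually.of_forall fun r hr => hbound r hr.1.le)
          (Continuous.intervalIntegrable (by fun_prop) _ _)
    _ ≤ C * Real.exp (κ * a) * Real.exp (-a * z.re) * I * (1 / κ) := by
        rw [intervalIntegral.integral_const_mul]
        gcongr
        exact integral_exp_neg_mul_le hκ
    _ = _ := by ring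

end ExponentialSums

/-- Fix `θ₀ ∈ (0,π/2)` and `ε > 0`.  There is `C > 0`, depending only on
`θ₀`, `ε` and `Λ`, such that for every Dirichlet polynomial `p` (with exponents in `Λ`) and
every `z ∈ S_{ε,θ₀}`:  `|p(z)| ≤ C e^{−(λ₁ cos θ₀ / 8)·Re z} ∫₀^∞ |p(t)| dt`. -/
theorem statement17 (Λ : ℕ → ℝ) (hpos : ∀ j, 0 < Λ j) (hmono : StrictMono Λ)
    (hsum : Summable fun j => 1 / Λ j)
    (θ₀ : ℝ) (hθ₀ : θ₀ ∈ Ioo (0 : ℝ) (Real.pi / 2)) (ε : ℝ) (hε : 0 < ε) :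
    ∃ C : ℝ, 0 < C ∧ ∀ p : ℂ → ℂ, IsDirichletPoly Λ p → ∀ z : ℂ, InSector ε θ₀ z →
      ‖p z‖ ≤ C * Real.exp (-(Λ 0 * Real.cos θ₀ / 8) * z.re) *
        ∫ t in Ioi (0 : ℝ), ‖p (t : ℂ)‖ := by
  obtain ⟨hθ0, hθ1⟩ := hθ₀
  have hs : 0 < Real.sin θ₀ := Real.sin_pos_of_pos_of_lt_pi hθ0 (by linarith [Real.pi_pos])
  have hc : 0 < Real.cos θ₀ := Real.cos_pos_of_mem_Ioo ⟨by linarith, hθ1⟩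
  have hcs := Real.sin_sq_add_cos_sq θ₀
  have hc1 := Real.cos_le_one θ₀
  set s := Real.sin θ₀
  set c := Real.cos θ₀
  set a := Λ 0 / 2 with ha_def
  have ha : 0 < a := half_pos (hpos 0)
  set κ := ε * c / 4
  have hκ : 0 < κ := by positivity
  obtain ⟨C, hC0, hC⟩ := exists_prod_one_add_le hpos hsum (k := 4 / s) (δ := κ)
    (by positivity) hκ
  refine ⟨C * Real.exp (κ * a) / κ, by positivity, ?_⟩
  rintro p ⟨N, b, rfl⟩ z ⟨hzε, hzim⟩
  have hal : ∀ j : Fin N, 2 * a ≤ Λ j := fun j => by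
    have := hmono.monotone (Nat.zero_le j)
    linarith
  have hz : 2 * κ ≤ z.re * c - |z.im| * s := by
    have h1 : |z.im| * s ≤ z.re / 2 * c := by
      calc |z.im| * s ≤ z.re / 2 * (c / s) * s := by gcongr
        _ = _ := by field_simp
    have h2 : ε * c ≤ z.re * c := by gcongr
    have h3 : 2 * κ = ε * c / 2 := by ring
    linarith
  have hCN : ∀ R : ℝ, 0 ≤ R →
      ∏ j : Fin N, (1 + 4 / s * R / Λ j) ≤ C * Real.exp (κ * R) := fun R hR => by
    rw [Fin.prod_univ_eq_prod_range (fun j => 1 + 4 / s * R / Λ j)]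
    exact hC _ R hR
  have htend := tendsto_finsetSum (Finset.univ : Finset (Fin N)) fun j _ =>
    (tendsto_sector_integral (μ := Λ j - a) (by linarith [hal j]) hc hs
      (z := z) (by linarith)).const_mul (b j * Complex.exp (-a * z))
  have hval : ∑ j : Fin N, b j * Complex.exp (-a * z) *
      (-(2 * Real.pi * Complex.I) * Complex.exp (-((Λ j - a : ℝ) : ℂ) * z)) =
      -(2 * Real.pi * Complex.I) * ∑ j : Fin N, b j * Complex.exp (-(Λ j : ℂ) * z) := by
    rw [Finset.mul_sum]
    refine Finset.sum_congr rfl fun j _ => ?_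
    have : Complex.exp (-(Λ j : ℂ) * z) =
        Complex.exp (-a * z) * Complex.exp (-((Λ j - a : ℝ) : ℂ) * z) := by
      rw [← Complex.exp_add]; congr 1; push_cast; ring
    rw [this]; ring
  rw [hval] at htend
  set K := C * Real.exp (κ * a) / κ * Real.exp (-a * z.re) *
    ∫ t in Ioi (0 : ℝ), ‖∑ j : Fin N, b j * Complex.exp (-(Λ j : ℂ) * t)‖ with hK
  have hlim := le_of_tendsto htend.norm (b := K + K) <| by
    filter_upwards [Filter.eventually_ge_atTop 0] with R hR
    simp_rw [mul_sub]
    rw [Finset.sum_sub_distrib]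
    refine (norm_sub_le _ _).trans (add_le_add ?_ ?_)
    · exact norm_ray_integral_le ha hal hc.le hs.ne' hcs b hκ
        (by rwa [abs_of_pos hs]) (by rwa [abs_of_pos hs]) hR
    · exact norm_ray_integral_le ha hal hc.le (neg_ne_zero.2 hs.ne') (by rwa [neg_sq]) b hκ
        (by rwa [abs_neg, abs_of_pos hs]) (by rwa [abs_neg, abs_of_pos hs]) hR
  have hnorm : ‖-(2 * Real.pi * Complex.I)‖ = 2 * Real.pi := by
    simp [abs_of_pos Real.pi_pos]
  rw [norm_mul, hnorm] at hlim
  have hpK : ‖∑ j : Fin N, b j * Complex.exp (-(Λ j : ℂ) * z)‖ ≤ K := by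
    nlinarith [Real.pi_gt_three, norm_nonneg (∑ j : Fin N, b j * Complex.exp (-(Λ j : ℂ) * z))]
  refine hpK.trans ?_
  have hΛ := hpos 0
  have hexp : Real.exp (-a * z.re) ≤ Real.exp (-(Λ 0 * c / 8) * z.re) := by
    refine Real.exp_le_exp.2 (mul_le_mul_of_nonneg_right ?_ (by linarith))
    rw [ha_def]
    nlinarith
  rw [hK]
  gcongr

end DirichletBBP
end
end

section
/- For every T ∈ (0,∞) there exists a constant C > 0, depending only on T and Λ, such that for every Dirichlet polynomial p (with exponents in Λ): ∫₀^∞ |p(t)| dt ≤ C·∫₀^T |p(t)| dt. -/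
/-!
Setting: `Λ = (λ_j)_{j≥0}` is a strictly increasing sequence of positive reals with
`Σ 1/λ_j < ∞`.  A Dirichlet polynomial (with exponents in `Λ`) is a finite sum
`p(z) = Σ_{j<N} c_j e^{-λ_j z}`.  For `θ₀ ∈ (0,π/2)` and `ε > 0`, the sector is
`S_{ε,θ₀} = {z = x+iy : x ≥ ε, |y| ≤ (x/2)·cot θ₀}`.
-/

open MeasureTheory Set
open scoped ENNReal

noncomputable section

namespace DirichletBBP

section Auxiliary

/-- The Dirichlet polynomial with exponents `l` and coefficients `c`. -/
def dirichletSum {N : ℕ} (l : Fin N → ℝ) (c : Fin N → ℂ) (z : ℂ) : ℂ :=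
  ∑ j, c j * Complex.exp (-(l j : ℂ) * z)

/-- The rational function with simple poles at the `l j`; `laplaceSum l c (-s)` is the Laplace
transform of `dirichletSum l c` at `s`. -/
def laplaceSum {N : ℕ} (l : Fin N → ℝ) (c : Fin N → ℂ) (w : ℂ) : ℂ :=
  ∑ j, c j / ((l j : ℂ) - w)

variable {N : ℕ} {l : Fin N → ℝ} {c : Fin N → ℂ}

lemma differentiable_dirichletSum : Differentiable ℂ (dirichletSum l c) := by
  unfold dirichletSum; fun_prop

lemma integrableOn_dirichletSum_mul_exp (hl : ∀ j, 0 < l j) {w : ℂ} (hw : w.re ≤ 0) :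
    IntegrableOn (fun t : ℝ => dirichletSum l c t * Complex.exp (w * t)) (Ioi 0) := by
  have : (fun t : ℝ => dirichletSum l c t * Complex.exp (w * t)) =
      fun t : ℝ => ∑ j, c j * Complex.exp ((w - l j) * t) := by
    ext t
    simp only [dirichletSum, Finset.sum_mul, mul_assoc, ← Complex.exp_add]
    refine Finset.sum_congr rfl fun j _ => ?_
    congr 2; ring
  rw [this]
  refine integrable_finsetSum _ fun j _ => Integrable.const_mul ?_ _
  exact integrableOn_exp_mul_complex_Ioi (by simpa using by linarith [hl j]) 0

lemma integrableOn_dirichletSum (hl : ∀ j, 0 < l j) :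
    IntegrableOn (fun t : ℝ => dirichletSum l c t) (Ioi 0) := by
  simpa using integrableOn_dirichletSum_mul_exp (c := c) hl (w := 0) (by simp)

lemma integral_dirichletSum_mul_exp (hl : ∀ j, 0 < l j) {w : ℂ} (hw : w.re ≤ 0) :
    ∫ t in Ioi (0 : ℝ), dirichletSum l c t * Complex.exp (w * t) = laplaceSum l c w := by
  have : (fun t : ℝ => dirichletSum l c t * Complex.exp (w * t)) =
      fun t : ℝ => ∑ j, c j * Complex.exp ((w - l j) * t) := by
    ext t
    simp only [dirichletSum, Finset.sum_mul, mul_assoc, ← Complex.exp_add]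
    refine Finset.sum_congr rfl fun j _ => ?_
    congr 2; ring
  have hre : ∀ j, (w - l j).re < 0 := fun j => by simpa using by linarith [hl j]
  rw [this, integral_finsetSum _ fun j _ => Integrable.const_mul
    (integrableOn_exp_mul_complex_Ioi (hre j) 0) _]
  refine Finset.sum_congr rfl fun j _ => ?_
  rw [integral_const_mul, integral_exp_mul_complex_Ioi (hre j), ← neg_sub w (l j : ℂ),
    Complex.ofReal_zero, mul_zero, Complex.exp_zero, div_neg, neg_div, mul_neg, mul_one_div]

lemma norm_laplaceSum_le_of_re_nonpos (hl : ∀ j, 0 < l j) {w : ℂ} (hw : w.re ≤ 0) :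
    ‖laplaceSum l c w‖ ≤ ∫ t in Ioi (0 : ℝ), ‖dirichletSum l c t‖ := by
  rw [← integral_dirichletSum_mul_exp hl hw]
  refine (norm_integral_le_integral_norm _).trans ?_
  refine setIntegral_mono_on (integrableOn_dirichletSum_mul_exp hl hw).norm
    (integrableOn_dirichletSum hl).norm measurableSet_Ioi fun t ht => ?_
  rw [norm_mul]
  refine mul_le_of_le_one_right (norm_nonneg _) ?_
  rw [Complex.norm_exp]
  simpa using mul_nonpos_of_nonpos_of_nonneg hw (le_of_lt ht)

lemma norm_sub_le_norm_add_of_re_nonneg {a : ℝ} (ha : 0 ≤ a) {w : ℂ} (hw : 0 ≤ w.re) :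
    ‖(a : ℂ) - w‖ ≤ ‖(a : ℂ) + w‖ := by
  rw [← sq_le_sq₀ (norm_nonneg _) (norm_nonneg _), Complex.sq_norm, Complex.sq_norm,
    Complex.normSq_apply, Complex.normSq_apply]
  simp
  nlinarith [mul_nonneg ha hw]

lemma le_norm_add_of_re_nonneg {a : ℝ} {w : ℂ} (hw : 0 ≤ w.re) :
    a ≤ ‖(a : ℂ) + w‖ := by
  refine le_trans ?_ (Complex.re_le_norm _)
  simpa using hw

/-- Dividing the Laplace transform by the Blaschke product of its poles keeps, on the right
half-plane, the bound valid on the imaginary axis. -/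
lemma norm_laplaceSum_mul_prod_le (hl : ∀ j, 0 < l j) {w : ℂ} (hw : 0 ≤ w.re)
    (hne : ∀ j, (l j : ℂ) - w ≠ 0) :
    ‖laplaceSum l c w‖ ≤ (∫ t in Ioi (0 : ℝ), ‖dirichletSum l c t‖) *
      ∏ j, (‖(l j : ℂ) + w‖ / ‖(l j : ℂ) - w‖) := by
  classical
  set I := ∫ t in Ioi (0 : ℝ), ‖dirichletSum l c t‖
  let G : ℂ → ℂ := fun w => ∑ j, c j / ((l j : ℂ) + w) *
    ∏ k ∈ Finset.univ.erase j, (((l k : ℂ) - w) / ((l k : ℂ) + w))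
  have hadd : ∀ w : ℂ, 0 ≤ w.re → ∀ j, (l j : ℂ) + w ≠ 0 := fun w hw j h => by
    have := le_norm_add_of_re_nonneg (a := l j) hw
    rw [h, norm_zero] at this
    linarith [hl j]
  have hG : ∀ w : ℂ, 0 ≤ w.re → (∀ j, (l j : ℂ) - w ≠ 0) →
      G w = laplaceSum l c w * ∏ j, (((l j : ℂ) - w) / ((l j : ℂ) + w)) := by
    intro w hw hne
    simp only [G, laplaceSum, Finset.sum_mul]
    refine Finset.sum_congr rfl fun j _ => ?_
    rw [← Finset.mul_prod_erase _ _ (Finset.mem_univ j), ← mul_assoc]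
    congr 1
    have := hne j
    have := hadd w hw j
    field_simp
  have hbd : ∀ w : ℂ, 0 ≤ w.re → ‖G w‖ ≤ ∑ j, ‖c j‖ / l j := by
    intro w hw
    refine norm_sum_le_of_le _ fun j _ => ?_
    rw [norm_mul, norm_div, norm_prod]
    have h1 : ‖c j‖ / ‖(l j : ℂ) + w‖ ≤ ‖c j‖ / l j := by
      have := hl j
      have := le_norm_add_of_re_nonneg (a := l j) hw
      gcongr
    refine (mul_le_of_le_one_right (by positivity) ?_).trans h1
    refine Finset.prod_le_one (fun _ _ => norm_nonneg _) fun k _ => ?_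
    rw [norm_div]
    exact div_le_one_of_le₀ (norm_sub_le_norm_add_of_re_nonneg (hl k).le hw) (norm_nonneg _)
  have hd : ∀ w : ℂ, 0 ≤ w.re → DifferentiableAt ℂ G w := by
    intro w hw
    have := hadd w hw
    refine DifferentiableAt.fun_sum fun j _ => DifferentiableAt.mul ?_
      (DifferentiableAt.fun_finsetProd fun k _ => ?_)
    · exact (differentiableAt_const _).div (by fun_prop) (this j)
    · exact DifferentiableAt.div (by fun_prop) (by fun_prop) (this k)
  have key : ‖G w‖ ≤ I := by
    refine PhragmenLindelof.right_half_plane_of_bounded_on_real ?_ ?_ ?_ ?_ hw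
    · refine DifferentiableOn.diffContOnCl fun z hz => (hd z ?_).differentiableWithinAt
      rw [Complex.closure_setOfPred_lt_re] at hz
      exact hz
    · refine ⟨1, by norm_num, 0, ?_⟩
      refine Asymptotics.IsBigO.of_bound (∑ j, ‖c j‖ / l j) ?_
      filter_upwards [Filter.mem_inf_of_right (Filter.mem_principal_self _)] with z hz
      simpa using hbd z (le_of_lt hz)
    · refine ⟨∑ j, ‖c j‖ / l j, ?_⟩
      rw [Filter.eventually_map]
      filter_upwards [Filter.eventually_ge_atTop 0] with x hx
      exact hbd x (by simpa using hx)
    · intro x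
      have hne : ∀ j, (l j : ℂ) - x * Complex.I ≠ 0 := fun j h => by
        have := congrArg Complex.re h
        simp at this
        linarith [hl j]
      rw [hG _ (by simp) hne, norm_mul, norm_prod]
      refine (mul_le_of_le_one_right (norm_nonneg _) ?_).trans
        (norm_laplaceSum_le_of_re_nonpos hl (by simp))
      refine Finset.prod_le_one (fun _ _ => norm_nonneg _) fun k _ => ?_
      rw [norm_div]
      exact div_le_one_of_le₀ (norm_sub_le_norm_add_of_re_nonneg (hl k).le (by simp))
        (norm_nonneg _)
  rw [hG w hw hne, norm_mul, norm_prod] at key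
  have hB : 0 < ∏ j, ‖((l j : ℂ) - w) / ((l j : ℂ) + w)‖ := by
    refine Finset.prod_pos fun j _ => norm_pos_iff.2 (div_ne_zero (hne j) (hadd w hw j))
  rw [← le_div_iff₀ hB] at key
  refine key.trans_eq ?_
  rw [div_eq_mul_inv, ← Finset.prod_inv_distrib]
  simp [inv_div]

lemma norm_add_div_norm_sub_le_s18 {a : ℝ} (ha : 0 < a) {w : ℂ}
    (hw : max a ‖w‖ / 4 ≤ ‖(a : ℂ) - w‖) :
    ‖(a : ℂ) + w‖ / ‖(a : ℂ) - w‖ ≤ 9 ∧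
      ‖(a : ℂ) + w‖ / ‖(a : ℂ) - w‖ ≤ Real.exp (8 * ‖w‖ * (1 / a)) := by
  have h1 : a / 4 ≤ ‖(a : ℂ) - w‖ := le_trans (by gcongr; exact le_max_left _ _) hw
  have h2 : ‖w‖ / 4 ≤ ‖(a : ℂ) - w‖ := le_trans (by gcongr; exact le_max_right _ _) hw
  have h0 : 0 < ‖(a : ℂ) - w‖ := by linarith
  have h3 : ‖(a : ℂ) + w‖ ≤ ‖(a : ℂ) - w‖ + 2 * ‖w‖ := by
    calc ‖(a : ℂ) + w‖ = ‖((a : ℂ) - w) + 2 * w‖ := by ring_nf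
      _ ≤ _ := (norm_add_le _ _).trans (by simp)
  constructor
  · rw [div_le_iff₀ h0]; linarith
  · refine le_trans ?_ (Real.add_one_le_exp _)
    rw [div_le_iff₀ h0]
    have : 2 * ‖w‖ ≤ 8 * ‖w‖ * (1 / a) * ‖(a : ℂ) - w‖ := by
      calc 2 * ‖w‖ = 8 * ‖w‖ * (1 / a) * (a / 4) := by field_simp; ring
        _ ≤ _ := by gcongr
    linarith

lemma exists_prod_norm_le {Λ : ℕ → ℝ} (hpos : ∀ j, 0 < Λ j)
    (hsum : Summable fun j => 1 / Λ j) {ε : ℝ} (hε : 0 < ε) :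
    ∃ K : ℝ, 0 < K ∧ ∀ (N : ℕ) (w : ℂ),
      (∀ j : Fin N, max (Λ j) ‖w‖ / 4 ≤ ‖(Λ j : ℂ) - w‖) →
      ∏ j : Fin N, (‖(Λ j : ℂ) + w‖ / ‖(Λ j : ℂ) - w‖) ≤ K * Real.exp (ε * ‖w‖) := by
  obtain ⟨s, hs⟩ := summable_iff_vanishing_norm.1 hsum (ε / 8) (by positivity)
  refine ⟨9 ^ s.card, by positivity, fun N w hw => ?_⟩
  have hw' : ∀ j ∈ Finset.range N, max (Λ j) ‖w‖ / 4 ≤ ‖(Λ j : ℂ) - w‖ :=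
    fun j hj => hw ⟨j, Finset.mem_range.1 hj⟩
  rw [Fin.prod_univ_eq_prod_range (fun j => ‖(Λ j : ℂ) + w‖ / ‖(Λ j : ℂ) - w‖) N,
    ← Finset.prod_inter_mul_prod_sdiff _ s]
  refine mul_le_mul ?_ ?_ (Finset.prod_nonneg fun _ _ => by positivity) (by positivity)
  · refine (Finset.prod_le_prod (g := fun _ => 9) (fun _ _ => by positivity) fun j hj =>
      (norm_add_div_norm_sub_le_s18 (hpos j) (hw' j (Finset.mem_inter.1 hj).1)).1).trans ?_
    rw [Finset.prod_const]
    exact pow_le_pow_right₀ (by norm_num) (Finset.card_le_card Finset.inter_subset_right)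
  · calc ∏ j ∈ Finset.range N \ s, (‖(Λ j : ℂ) + w‖ / ‖(Λ j : ℂ) - w‖)
        ≤ ∏ j ∈ Finset.range N \ s, Real.exp (8 * ‖w‖ * (1 / Λ j)) :=
          Finset.prod_le_prod (fun _ _ => by positivity) fun j hj =>
            (norm_add_div_norm_sub_le_s18 (hpos j) (hw' j (Finset.mem_sdiff.1 hj).1)).2
      _ = Real.exp (8 * ‖w‖ * ∑ j ∈ Finset.range N \ s, 1 / Λ j) := by
          rw [← Real.exp_sum, Finset.mul_sum]
      _ ≤ Real.exp (8 * ‖w‖ * (ε / 8)) := by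
          gcongr
          exact (le_abs_self _).trans (hs _ Finset.sdiff_disjoint).le
      _ = _ := by ring_nf

/-- A point whose square lies on a circle that passes through `a ^ 2` and is nearly a vertical
line keeps away from every real number of `[4 * a, D]`. -/
lemma max_div_four_le_norm_sub {a D ρ : ℝ} (ha : 0 < a) (hρ : 8 * D ^ 4 / a ^ 2 ≤ ρ)
    (hρ0 : 0 < ρ) {w : ℂ}
    (hs : (w ^ 2).re ≤ ‖w‖ ^ 4 / (2 * ρ) + a ^ 2) {x : ℝ} (hx : 4 * a ≤ x) (hxD : x ≤ D) :
    max x ‖w‖ / 4 ≤ ‖(x : ℂ) - w‖ := by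
  have hx0 : 0 < x := by linarith
  have hr := norm_nonneg w
  have t1 : x - ‖w‖ ≤ ‖(x : ℂ) - w‖ := by
    simpa [abs_of_pos hx0] using norm_sub_norm_le (x : ℂ) w
  have t2 : ‖w‖ - x ≤ ‖(x : ℂ) - w‖ := by
    simpa [abs_of_pos hx0, norm_sub_rev] using norm_sub_norm_le w (x : ℂ)
  rcases le_or_gt ‖w‖ (x / 2) with h1 | h1
  · rw [max_eq_left (by linarith)]; linarith
  rcases le_or_gt (2 * D) ‖w‖ with h2 | h2
  · rw [max_eq_right (by linarith)]; linarith
  have h3 : ‖w‖ ^ 4 / (2 * ρ) ≤ a ^ 2 := by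
    rw [div_le_iff₀ (by positivity)]
    rw [div_le_iff₀ (by positivity)] at hρ
    have : ‖w‖ ^ 4 ≤ (2 * D) ^ 4 := by gcongr
    nlinarith
  have h4 : (w ^ 2).re ≤ ‖w‖ ^ 2 / 2 := by nlinarith
  have h5 : ‖w‖ ^ 2 = w.re ^ 2 + w.im ^ 2 := by
    rw [Complex.sq_norm, Complex.normSq_apply]; ring
  have h6 : (w ^ 2).re = w.re ^ 2 - w.im ^ 2 := by rw [pow_two, Complex.mul_re]; ring
  have h7 : ‖(x : ℂ) - w‖ ^ 2 = (x - w.re) ^ 2 + w.im ^ 2 := by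
    rw [Complex.sq_norm, Complex.normSq_apply]; simp; ring
  have h8 : w.re ^ 2 ≤ 3 / 4 * ‖w‖ ^ 2 := by linarith
  rw [← sq_le_sq₀ (by positivity) (norm_nonneg _), h7]
  have h9 : w.im ^ 2 ≥ ‖w‖ ^ 2 / 4 := by linarith
  rcases max_cases x ‖w‖ with ⟨h, h'⟩ | ⟨h, h'⟩ <;> rw [h]
  · nlinarith [sq_nonneg (x - w.re - w.re / 3)]
  · nlinarith [sq_nonneg (x - w.re)]

lemma norm_circleAverage_le_re {F g : ℂ → ℂ} {z₀ : ℂ} {R : ℝ} (hR : 0 < R)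
    (hg : DifferentiableOn ℂ g (Metric.closedBall z₀ R))
    (h : ∀ z ∈ Metric.sphere z₀ R, ‖F z‖ ≤ (g z).re) :
    ‖Real.circleAverage F z₀ R‖ ≤ (g z₀).re := by
  have hc : CircleIntegrable g z₀ R :=
    (hg.continuousOn.mono Metric.sphere_subset_closedBall).circleIntegrable hR.le
  have hmean : Real.circleAverage g z₀ R = g z₀ := by
    refine circleAverage_of_differentiable_on_off_countable countable_empty ?_ ?_
    · rw [abs_of_pos hR]; exact hg.continuousOn
    · intro z hz
      rw [abs_of_pos hR, sdiff_empty] at hz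
      exact (hg z (Metric.ball_subset_closedBall hz)).differentiableAt
        (Metric.closedBall_mem_nhds_of_mem hz)
  have hre := Complex.reCLM.circleAverage_comp_comm hc
  rw [hmean, Complex.reCLM_apply] at hre
  rw [← hre, Real.circleAverage_def, Real.circleAverage_def, norm_smul, smul_eq_mul,
    Real.norm_of_nonneg (by positivity)]
  refine mul_le_mul_of_nonneg_left ?_ (by positivity)
  refine intervalIntegral.norm_integral_le_of_norm_le (by positivity) ?_ ?_
  · refine Filter.Eventually.of_forall fun θ _ => ?_
    exact h _ (circleMap_mem_sphere z₀ hR.le θ)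
  · exact (intervalIntegrable_iff_integrableOn_Ioc_of_le (by positivity)).2
      (Complex.reCLM.integrable_comp hc.1)

lemma sqrt_sq (w : ℂ) : Complex.sqrt w ^ 2 = w := by
  simp [Complex.sqrt]

lemma sqrt_re_nonneg (w : ℂ) : 0 ≤ (Complex.sqrt w).re := by
  rw [Complex.sqrt, Complex.cpow_inv_two_re]; positivity

lemma abs_sqrt_im_le {w : ℂ} (hw : 0 ≤ w.re) :
    |(Complex.sqrt w).im| ≤ (Complex.sqrt w).re := by
  rw [Complex.sqrt, Complex.cpow_inv_two_re, Complex.abs_cpow_inv_two_im]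
  gcongr; linarith

lemma sqrt_ofReal_sq {x : ℝ} (hx : 0 ≤ x) : Complex.sqrt ((x : ℂ) ^ 2) = x := by
  have h := sqrt_sq ((x : ℂ) ^ 2)
  rcases sq_eq_sq_iff_eq_or_eq_neg.1 h with h | h
  · exact h
  · have h1 := sqrt_re_nonneg ((x : ℂ) ^ 2)
    rw [h] at h1
    have : x = 0 := by
      simp at h1; linarith
    rw [h, this]; simp

lemma differentiableAt_sqrt {w : ℂ} (hw : 0 < w.re) : DifferentiableAt ℂ Complex.sqrt w := by
  unfold Complex.sqrt
  exact DifferentiableAt.cpow_const differentiableAt_id (Or.inl hw)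

lemma dirichletSum_eq_circleAverage {z₀ : ℂ} {R : ℝ} (hR : 0 < R)
    (h0 : ∀ w ∈ Metric.closedBall z₀ R, 0 < w.re) (hl : ∀ j, 0 < l j)
    (hlR : ∀ j, (l j : ℂ) ^ 2 ∈ Metric.ball z₀ R) (z : ℂ) :
    dirichletSum l c z = Real.circleAverage (fun w => (w - z₀) *
      (Complex.exp (-Complex.sqrt w * z) / (2 * Complex.sqrt w) *
        -laplaceSum l c (Complex.sqrt w))) z₀ R := by
  have hne : ∀ w ∈ Metric.closedBall z₀ R, Complex.sqrt w ≠ 0 := by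
    intro w hw h
    have h1 := sqrt_sq w
    have h2 := h0 w hw
    rw [← h1, h] at h2
    simp at h2
  let f : Fin N → ℂ → ℂ := fun j w => c j *
    (Complex.exp (-Complex.sqrt w * z) / (2 * Complex.sqrt w) * (Complex.sqrt w + l j))
  have hf : ∀ j, DifferentiableOn ℂ (f j) (Metric.closedBall z₀ R) := by
    intro j w hw
    have h1 := differentiableAt_sqrt (h0 w hw)
    have h2 := hne w hw
    refine DifferentiableAt.differentiableWithinAt ?_
    refine DifferentiableAt.const_mul (DifferentiableAt.mul (DifferentiableAt.div ?_ ?_ ?_) ?_) _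
    · exact (h1.neg.mul_const z).cexp
    · exact h1.const_mul _
    · exact mul_ne_zero two_ne_zero h2
    · exact h1.add_const _
  have hterm : ∀ j, Real.circleAverage
      (fun w => ((w - z₀) / (w - (l j : ℂ) ^ 2)) • f j w) z₀ R =
      c j * Complex.exp (-(l j : ℂ) * z) := by
    intro j
    have hd : DiffContOnCl ℂ (f j) (Metric.ball z₀ |R|) := by
      refine DifferentiableOn.diffContOnCl ?_
      rw [abs_of_pos hR, closure_ball _ hR.ne']
      exact hf j
    rw [hd.circleAverage_smul_div (by rw [abs_of_pos hR]; exact hlR j)]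
    simp only [f, sqrt_ofReal_sq (hl j).le]
    have : (l j : ℂ) ≠ 0 := by exact_mod_cast (hl j).ne'
    field_simp
    ring
  have hint : ∀ j, CircleIntegrable (fun w => ((w - z₀) / (w - (l j : ℂ) ^ 2)) • f j w) z₀ R := by
    intro j
    refine ContinuousOn.circleIntegrable hR.le ?_
    have h1 : ContinuousOn (fun w : ℂ => w - z₀) (Metric.sphere z₀ R) := by fun_prop
    have h2 : ContinuousOn (fun w : ℂ => w - (l j : ℂ) ^ 2) (Metric.sphere z₀ R) := by fun_prop
    refine (h1.div h2 ?_).smul ((hf j).continuousOn.mono Metric.sphere_subset_closedBall)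
    intro w hw h
    rw [sub_eq_zero.1 h] at hw
    exact (Metric.mem_ball.1 (hlR j)).ne (Metric.mem_sphere.1 hw)
  unfold dirichletSum
  rw [← Finset.sum_congr rfl fun j _ => hterm j,
    ← Real.circleAverage_fun_sum fun j _ => hint j]
  refine Real.circleAverage_congr_sphere fun w hw => ?_
  rw [abs_of_pos hR] at hw
  have hw0 := hne w (Metric.sphere_subset_closedBall hw)
  simp only [laplaceSum, smul_eq_mul, f, ← Finset.sum_neg_distrib, Finset.mul_sum]
  refine Finset.sum_congr rfl fun j _ => ?_
  have h1 : w - (l j : ℂ) ^ 2 ≠ 0 := by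
    intro h
    rw [sub_eq_zero.1 h] at hw
    exact (Metric.mem_ball.1 (hlR j)).ne (Metric.mem_sphere.1 hw)
  have h2 : w - (l j : ℂ) ^ 2 = (Complex.sqrt w - l j) * (Complex.sqrt w + l j) := by
    conv_lhs => rw [← sqrt_sq w]
    ring
  rw [h2] at h1 ⊢
  have h3 := left_ne_zero_of_mul h1
  have h4 := right_ne_zero_of_mul h1
  have h5 : (l j : ℂ) - Complex.sqrt w ≠ 0 := by rw [← neg_sub]; exact neg_ne_zero.2 h3
  rw [← neg_sub (Complex.sqrt w) (l j : ℂ)]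
  field_simp

lemma norm_le_three_halves_re {w : ℂ} (hw : |w.im| ≤ w.re) : ‖w‖ ≤ 3 / 2 * w.re := by
  have h0 : 0 ≤ w.re := (abs_nonneg _).trans hw
  rw [← sq_le_sq₀ (norm_nonneg _) (by positivity), Complex.sq_norm, Complex.normSq_apply]
  nlinarith [abs_mul_abs_self w.im, abs_nonneg w.im]

lemma norm_mul_re_le_re_mul {w z : ℂ} (hw : |w.im| ≤ w.re) (hz : |z.im| ≤ z.re / 2) :
    ‖w‖ * z.re / 3 ≤ (w * z).re := by
  have h0 : 0 ≤ w.re := (abs_nonneg _).trans hw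
  have hz0 : 0 ≤ z.re := by linarith [abs_nonneg z.im]
  have h1 := mul_le_mul_of_nonneg_right (norm_le_three_halves_re hw) hz0
  have h2 : w.im * z.im ≤ w.re * (z.re / 2) :=
    (le_abs_self _).trans (by rw [abs_mul]; gcongr)
  rw [Complex.mul_re]
  linarith

/-- The exponential decay of `exp (-w z)` on the sector `|arg w| ≤ π / 4` absorbs a slower
exponential growth. -/
lemma norm_exp_div_mul_le {x₀ a : ℝ} (hx₀ : 0 < x₀) (ha : 0 < a) {w z : ℂ} (haw : a ≤ ‖w‖)
    (hw : |w.im| ≤ w.re) (hxz : x₀ ≤ z.re) (hz : |z.im| ≤ z.re / 2) :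
    ‖Complex.exp (-w * z) / (2 * w)‖ * Real.exp (x₀ / 12 * ‖w‖) ≤
      12 / (a * (x₀ / 12) ^ 4) * Real.exp (-(a / 6) * z.re) / ‖w‖ ^ 4 := by
  have hr : 0 < ‖w‖ := ha.trans_le haw
  have h1 := norm_mul_re_le_re_mul hw hz
  have h2 : Real.exp (-(w * z).re) * Real.exp (x₀ / 12 * ‖w‖) ≤
      Real.exp (-(x₀ / 12 * ‖w‖)) * Real.exp (-(a / 6) * z.re) := by
    rw [← Real.exp_add, ← Real.exp_add]
    refine Real.exp_le_exp.2 ?_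
    have h3 : ‖w‖ * x₀ ≤ ‖w‖ * z.re := by gcongr
    have h4 : a * z.re ≤ ‖w‖ * z.re := by
      have : 0 ≤ z.re := by linarith
      gcongr
    linarith
  have h5 : Real.exp (-(x₀ / 12 * ‖w‖)) ≤ 24 / (x₀ / 12 * ‖w‖) ^ 4 := by
    have := Real.pow_div_factorial_le_exp (x₀ / 12 * ‖w‖) (by positivity) 4
    rw [Real.exp_neg, inv_le_comm₀ (by positivity) (by positivity), inv_div]
    simpa [Nat.factorial] using this
  rw [norm_div, norm_mul, Complex.norm_exp, neg_mul, Complex.neg_re]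
  calc Real.exp (-(w * z).re) / (‖(2 : ℂ)‖ * ‖w‖) * Real.exp (x₀ / 12 * ‖w‖)
      = Real.exp (-(w * z).re) * Real.exp (x₀ / 12 * ‖w‖) / (2 * ‖w‖) := by
        simp; ring
    _ ≤ 24 / (x₀ / 12 * ‖w‖) ^ 4 * Real.exp (-(a / 6) * z.re) / (2 * a) := by
        refine div_le_div₀ (by positivity) (h2.trans ?_) (by positivity) (by gcongr)
        gcongr
    _ = _ := by field_simp; ring

set_option maxHeartbeats 400000 in
/-- On the sector `|Im z| ≤ Re z / 2`, away from the origin, Dirichlet polynomials are controlled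
by their `L¹` norm on the half-line, with uniform exponential decay. -/
theorem exists_norm_dirichletSum_le {Λ : ℕ → ℝ} (hpos : ∀ j, 0 < Λ j) (hmono : StrictMono Λ)
    (hsum : Summable fun j => 1 / Λ j) {x₀ : ℝ} (hx₀ : 0 < x₀) :
    ∃ K : ℝ, 0 < K ∧ ∀ (N : ℕ) (c : Fin N → ℂ) (z : ℂ), x₀ ≤ z.re → |z.im| ≤ z.re / 2 →
      ‖dirichletSum (fun j : Fin N => Λ j) c z‖ ≤ K * Real.exp (-(Λ 0 / 24) * z.re) *
        ∫ t in Ioi (0 : ℝ), ‖dirichletSum (fun j : Fin N => Λ j) c t‖ := by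
  obtain ⟨K₁, hK₁, hK⟩ := exists_prod_norm_le hpos hsum (ε := x₀ / 12) (by positivity)
  set a := Λ 0 / 4 with ha_def
  have ha : 0 < a := by have := hpos 0; positivity
  set K₀ := K₁ * (12 / (a * (x₀ / 12) ^ 4)) with hK₀
  refine ⟨K₀ / a ^ 2, by positivity, fun N c z hxz hz => ?_⟩
  set l : Fin N → ℝ := fun j => Λ j with hl_def
  have hl : ∀ j, 0 < l j := fun j => hpos j
  set I := ∫ t in Ioi (0 : ℝ), ‖dirichletSum l c t‖ with hI
  have hI0 : 0 ≤ I := integral_nonneg fun _ => norm_nonneg _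
  set E := Real.exp (-(Λ 0 / 24) * z.re) with hE
  set D := ∑ j, l j with hD
  have hlD : ∀ j, l j ≤ D := fun j =>
    Finset.single_le_sum (fun k _ => (hl k).le) (Finset.mem_univ j)
  have hla : ∀ j, 4 * a ≤ l j := fun j => by
    have : Λ 0 ≤ l j := hmono.monotone (Nat.zero_le _)
    linarith
  set ρ := 8 * D ^ 4 / a ^ 2 + D ^ 2 + 1 with hρ_def
  have hρ1 : 8 * D ^ 4 / a ^ 2 ≤ ρ := by nlinarith [sq_nonneg D]
  have hρ2 : D ^ 2 < ρ := by
    have : 0 ≤ 8 * D ^ 4 / a ^ 2 := by positivity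
    linarith
  have hρ : 0 < ρ := by positivity
  set b := ρ + a ^ 2 with hb_def
  have hb : 0 < b := by positivity
  have hball : ∀ w ∈ Metric.closedBall (b : ℂ) ρ, a ^ 2 ≤ w.re := by
    intro w hw
    rw [mem_closedBall_iff_norm] at hw
    have h1 := (Complex.abs_re_le_norm (w - b)).trans hw
    rw [Complex.sub_re, Complex.ofReal_re, abs_le] at h1
    linarith [h1.1]
  have hball0 : ∀ w ∈ Metric.closedBall (b : ℂ) ρ, 0 < w.re := fun w hw =>
    lt_of_lt_of_le (by positivity) (hball w hw)
  have hlball : ∀ j, (l j : ℂ) ^ 2 ∈ Metric.ball (b : ℂ) ρ := by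
    intro j
    rw [mem_ball_iff_norm]
    have : (l j : ℂ) ^ 2 - b = ((l j ^ 2 - b : ℝ) : ℂ) := by push_cast; ring
    rw [this, Complex.norm_real, Real.norm_eq_abs, abs_lt]
    have h1 : l j ^ 2 ≤ D ^ 2 := by
      have := (hl j).le
      have := hlD j
      gcongr
    have h2 : a ^ 2 < l j ^ 2 := by
      have := hla j
      gcongr
      linarith
    constructor <;> nlinarith
  rw [dirichletSum_eq_circleAverage hρ hball0 hl hlball z]
  set M := ρ * (K₀ * E * I) * (2 / (a ^ 2 * (2 * ρ + a ^ 2))) * b with hM_def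
  have hM : 0 ≤ M := by positivity
  have hg : DifferentiableOn ℂ (fun w => (M : ℂ) * w⁻¹) (Metric.closedBall (b : ℂ) ρ) := by
    intro w hw
    have : w ≠ 0 := fun h => by
      have := hball0 w hw
      simp [h] at this
    exact ((differentiableAt_inv this).const_mul _).differentiableWithinAt
  refine (norm_circleAverage_le_re hρ hg fun w hw => ?_).trans ?_
  · have hwre := hball w (Metric.sphere_subset_closedBall hw)
    have hwre0 := hball0 w (Metric.sphere_subset_closedBall hw)
    set s := Complex.sqrt w with hs
    have hs2 : s ^ 2 = w := sqrt_sq w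
    have hsn : ‖s‖ ^ 2 = ‖w‖ := by rw [← norm_pow, hs2]
    have hsn4 : ‖s‖ ^ 4 = ‖w‖ ^ 2 := by rw [← hsn]; ring
    have hw0 : 0 < ‖w‖ := hwre0.trans_le (Complex.re_le_norm w)
    have has : a ≤ ‖s‖ := by
      rw [← sq_le_sq₀ ha.le (norm_nonneg _), hsn]
      exact hwre.trans (Complex.re_le_norm w)
    have hsim := abs_sqrt_im_le hwre0.le
    have hsre := sqrt_re_nonneg w
    rw [mem_sphere_iff_norm] at hw
    have hcirc : ‖w‖ ^ 2 + a ^ 2 * (2 * ρ + a ^ 2) = 2 * b * w.re := by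
      have h1 : ‖w - b‖ ^ 2 = ρ ^ 2 := by rw [hw]
      rw [Complex.sq_norm, Complex.normSq_apply] at h1 ⊢
      simp at h1
      rw [hb_def] at h1 ⊢
      linarith
    have hsq : (s ^ 2).re ≤ ‖s‖ ^ 4 / (2 * ρ) + a ^ 2 := by
      rw [hs2, hsn4, div_add' _ _ _ (by positivity), le_div_iff₀ (by positivity)]
      have := sq_nonneg a
      nlinarith
    have hsep : ∀ j : Fin N, max (Λ j) ‖s‖ / 4 ≤ ‖(Λ j : ℂ) - s‖ := fun j =>
      max_div_four_le_norm_sub ha hρ1 hρ hsq (hla j) (hlD j)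
    have hlap : ‖laplaceSum l c s‖ ≤ I * (K₁ * Real.exp (x₀ / 12 * ‖s‖)) := by
      refine (norm_laplaceSum_mul_prod_le hl hsre fun j => ?_).trans
        (mul_le_mul_of_nonneg_left (hK N s hsep) hI0)
      refine norm_pos_iff.1 (lt_of_lt_of_le ?_ (hsep j))
      have : 0 < max (Λ j) ‖s‖ := lt_max_of_lt_left (hpos j)
      positivity
    have hexp := norm_exp_div_mul_le hx₀ ha has hsim hxz hz
    have hE' : Real.exp (-(a / 6) * z.re) = E := by rw [hE, ha_def]; ring_nf
    rw [hE', hsn4] at hexp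
    rw [norm_mul, hw, norm_mul, norm_neg]
    have hinv : ((M : ℂ) * w⁻¹).re = M * (w.re / ‖w‖ ^ 2) := by
      rw [Complex.re_ofReal_mul, Complex.inv_re, Complex.sq_norm]
    rw [hinv]
    calc ρ * (‖Complex.exp (-s * z) / (2 * s)‖ * ‖laplaceSum l c s‖)
        ≤ ρ * (‖Complex.exp (-s * z) / (2 * s)‖ * (I * (K₁ * Real.exp (x₀ / 12 * ‖s‖)))) := by
          gcongr
      _ = ρ * (I * K₁) * (‖Complex.exp (-s * z) / (2 * s)‖ * Real.exp (x₀ / 12 * ‖s‖)) := by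
          ring
      _ ≤ ρ * (I * K₁) * (12 / (a * (x₀ / 12) ^ 4) * E / ‖w‖ ^ 2) := by gcongr
      _ = ρ * (K₀ * E * I) * (1 / ‖w‖ ^ 2) := by rw [hK₀]; ring
      _ ≤ ρ * (K₀ * E * I) * (2 / (a ^ 2 * (2 * ρ + a ^ 2)) * b * (w.re / ‖w‖ ^ 2)) := by
          refine mul_le_mul_of_nonneg_left ?_ (by positivity)
          have h1 : 1 ≤ 2 / (a ^ 2 * (2 * ρ + a ^ 2)) * b * w.re := by
            rw [div_mul_eq_mul_div, div_mul_eq_mul_div, one_le_div (by positivity), ← hcirc]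
            exact le_add_of_nonneg_left (sq_nonneg _)
          rw [← mul_div_assoc]
          exact div_le_div_of_nonneg_right h1 (sq_nonneg _)
      _ = _ := by rw [hM_def]; ring
  · have hre : ((M : ℂ) * (b : ℂ)⁻¹).re = M / b := by
      rw [← Complex.ofReal_inv, ← Complex.ofReal_mul, Complex.ofReal_re, div_eq_mul_inv]
    rw [hre, hM_def, mul_div_assoc, div_self hb.ne', mul_one]
    have : ρ * (2 / (a ^ 2 * (2 * ρ + a ^ 2))) ≤ 1 / a ^ 2 := by
      rw [mul_div_assoc', div_le_div_iff₀ (by positivity) (by positivity)]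
      nlinarith [sq_nonneg a, mul_nonneg (sq_nonneg a) (sq_nonneg a)]
    calc ρ * (K₀ * E * I) * (2 / (a ^ 2 * (2 * ρ + a ^ 2)))
        = (ρ * (2 / (a ^ 2 * (2 * ρ + a ^ 2)))) * (K₀ * E * I) := by ring
      _ ≤ 1 / a ^ 2 * (K₀ * E * I) := by gcongr
      _ = _ := by ring

/-- Montel's theorem on a compact convex set, for a sequence of entire functions bounded near
that set. -/
lemma exists_subseq_tendstoUniformlyOn {f : ℕ → ℂ → ℂ} (hf : ∀ n, Differentiable ℂ (f n))
    {K : Set ℂ} (hK : IsCompact K) (hconv : Convex ℝ K) {δ M : ℝ} (hδ : 0 < δ)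
    (hM : ∀ n, ∀ x ∈ K, ∀ z ∈ Metric.closedBall x δ, ‖f n z‖ ≤ M) :
    ∃ (g : ℂ → ℂ) (φ : ℕ → ℕ), StrictMono φ ∧
      TendstoUniformlyOn (fun n => f (φ n)) g Filter.atTop K := by
  have : CompactSpace K := isCompact_iff_compactSpace.1 hK
  have hlip : ∀ n, LipschitzOnWith (M / δ).toNNReal (f n) K := by
    intro n
    refine hconv.lipschitzOnWith_of_nnnorm_deriv_le (fun x _ => (hf n) x) fun x hx => ?_
    rw [← NNReal.coe_le_coe, coe_nnnorm]
    exact (Complex.norm_deriv_le_of_forall_mem_sphere_norm_le hδ (hf n).diffContOnCl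
      fun z hz => hM n x hx z (Metric.sphere_subset_closedBall hz)).trans (Real.le_coe_toNNReal _)
  let F : ℕ → BoundedContinuousFunction K ℂ := fun n =>
    BoundedContinuousFunction.mkOfCompact ⟨fun x : K => f n x, by
      have := (hf n).continuous
      fun_prop⟩
  have hcpt : IsCompact (closure (range F)) := by
    refine BoundedContinuousFunction.arzela_ascoli (Metric.closedBall 0 M)
      (isCompact_closedBall 0 M) (range F) ?_ ?_
    · rintro _ x ⟨n, rfl⟩
      rw [mem_closedBall_zero_iff]
      exact hM n x x.2 x (Metric.mem_closedBall_self hδ.le)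
    · refine (LipschitzWith.uniformEquicontinuous _ (M / δ).toNNReal ?_).equicontinuous
      rintro ⟨_, n, rfl⟩
      exact lipschitzOnWith_iff_restrict.1 (hlip n)
  obtain ⟨G, -, φ, hφ, hG⟩ := hcpt.tendsto_subseq fun n => subset_closure (mem_range_self n)
  refine ⟨Function.extend Subtype.val G 0, φ, hφ, ?_⟩
  rw [tendstoUniformlyOn_iff_tendstoUniformly_comp_coe]
  have hext : Function.extend Subtype.val G 0 ∘ (Subtype.val : K → ℂ) = G :=
    funext (Subtype.val_injective.extend_apply G 0)
  rw [hext]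
  exact BoundedContinuousFunction.tendsto_iff_tendstoUniformly.1 hG

lemma tendsto_setIntegral_norm {f : ℕ → ℂ → ℂ} (hf : ∀ n, Continuous (f n)) {g : ℂ → ℂ}
    {K : Set ℂ} {M : ℝ} (hM : ∀ n, ∀ x ∈ K, ‖f n x‖ ≤ M)
    (h : TendstoUniformlyOn f g Filter.atTop K) {u v : ℝ}
    (huv : ∀ t ∈ Ioc u v, (t : ℂ) ∈ K) :
    Filter.Tendsto (fun n => ∫ t in Ioc u v, ‖f n (t : ℂ)‖) Filter.atTop
      (nhds (∫ t in Ioc u v, ‖g (t : ℂ)‖)) := by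
  refine tendsto_integral_of_dominated_convergence (fun _ => M) (fun n => ?_)
    (integrable_const M) (fun n => ?_) ?_
  · have := hf n
    exact Continuous.aestronglyMeasurable (by fun_prop)
  · rw [ae_restrict_iff' measurableSet_Ioc]
    refine Filter.Eventually.of_forall fun t ht => ?_
    rw [norm_norm]
    exact hM n t (huv t ht)
  · rw [ae_restrict_iff' measurableSet_Ioc]
    exact Filter.Eventually.of_forall fun t ht => (h.tendsto_at (huv t ht)).norm

/-- A sequence of entire functions that is bounded near a compact convex set and tends to zero in
mean on a real segment of its interior tends to zero in mean, along a subsequence, on every real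
segment of its interior. -/
lemma exists_subseq_tendsto_setIntegral_norm {f : ℕ → ℂ → ℂ} (hf : ∀ n, Differentiable ℂ (f n))
    {K : Set ℂ} (hK : IsCompact K) (hconv : Convex ℝ K) {δ M : ℝ} (hδ : 0 < δ)
    (hM : ∀ n, ∀ x ∈ K, ∀ z ∈ Metric.closedBall x δ, ‖f n z‖ ≤ M) {u v : ℝ} (huv : u < v)
    (huvK : ∀ t ∈ Ioc u v, (t : ℂ) ∈ interior K)
    (hzero : Filter.Tendsto (fun n => ∫ t in Ioc u v, ‖f n (t : ℂ)‖) Filter.atTop (nhds 0))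
    {a b : ℝ} (habK : ∀ t ∈ Ioc a b, (t : ℂ) ∈ interior K) :
    ∃ φ : ℕ → ℕ, StrictMono φ ∧
      Filter.Tendsto (fun n => ∫ t in Ioc a b, ‖f (φ n) (t : ℂ)‖) Filter.atTop (nhds 0) := by
  obtain ⟨g, φ, hφ, hg⟩ := exists_subseq_tendstoUniformlyOn hf hK hconv hδ hM
  refine ⟨φ, hφ, ?_⟩
  have hM' : ∀ n, ∀ x ∈ K, ‖f (φ n) x‖ ≤ M := fun n x hx =>
    hM _ x hx x (Metric.mem_closedBall_self hδ.le)
  have hlim : ∀ {p q : ℝ}, (∀ t ∈ Ioc p q, (t : ℂ) ∈ interior K) →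
      Filter.Tendsto (fun n => ∫ t in Ioc p q, ‖f (φ n) (t : ℂ)‖) Filter.atTop
        (nhds (∫ t in Ioc p q, ‖g (t : ℂ)‖)) := fun hpq =>
    tendsto_setIntegral_norm (fun n => (hf _).continuous) hM' hg
      fun t ht => interior_subset (hpq t ht)
  have hgd : DifferentiableOn ℂ g (interior K) :=
    (hg.mono interior_subset).tendstoLocallyUniformlyOn.differentiableOn
      (Filter.Eventually.of_forall fun n => (hf _).differentiableOn) isOpen_interior
  have hgK : ContinuousOn g K :=
    hg.continuousOn (Filter.Eventually.of_forall fun n => (hf _).continuous.continuousOn).frequently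
  have hint0 : ∫ t in Ioc u v, ‖g (t : ℂ)‖ = 0 :=
    tendsto_nhds_unique (hlim huvK) (hzero.comp hφ.tendsto_atTop)
  have hcont : ContinuousOn (fun t : ℝ => g (t : ℂ)) (Ioc u v) :=
    hgK.comp Complex.continuous_ofReal.continuousOn fun t ht => interior_subset (huvK t ht)
  have hgM : ∀ t ∈ Ioc u v, ‖g (t : ℂ)‖ ≤ M := fun t ht =>
    le_of_tendsto (hg.tendsto_at (interior_subset (huvK t ht))).norm
      (Filter.Eventually.of_forall fun n => hM' n _ (interior_subset (huvK t ht)))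
  have hgi : IntegrableOn (fun t : ℝ => ‖g (t : ℂ)‖) (Ioc u v) := by
    refine Integrable.mono' (g := fun _ => M) (integrable_const M)
      (hcont.norm.aestronglyMeasurable measurableSet_Ioc) ?_
    rw [ae_restrict_iff' measurableSet_Ioc]
    exact Filter.Eventually.of_forall fun t ht => by rw [norm_norm]; exact hgM t ht
  have hae : (fun t : ℝ => g (t : ℂ)) =ᵐ[volume.restrict (Ioo u v)] fun _ => 0 := by
    have := (integral_eq_zero_iff_of_nonneg (fun _ => norm_nonneg _) hgi).1 hint0
    refine ae_restrict_of_ae_restrict_of_subset Ioo_subset_Ioc_self ?_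
    filter_upwards [this] with t ht using norm_eq_zero.1 ht
  have hIoo : EqOn (fun t : ℝ => g (t : ℂ)) (fun _ => 0) (Ioo u v) :=
    Measure.eqOn_open_of_ae_eq hae isOpen_Ioo (hcont.mono Ioo_subset_Ioc_self) continuousOn_const
  have hm : (u + v) / 2 ∈ Ioo u v := ⟨by linarith, by linarith⟩
  have hfreq : ∃ᶠ z in nhdsWithin (((u + v) / 2 : ℝ) : ℂ) {(((u + v) / 2 : ℝ) : ℂ)}ᶜ,
      g z = 0 := by
    have ht : Filter.Tendsto (fun t : ℝ => (t : ℂ)) (nhdsWithin ((u + v) / 2) {(u + v) / 2}ᶜ)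
        (nhdsWithin (((u + v) / 2 : ℝ) : ℂ) {(((u + v) / 2 : ℝ) : ℂ)}ᶜ) :=
      Complex.continuous_ofReal.continuousWithinAt.tendsto_nhdsWithin fun t ht => by
        simpa only [mem_compl_iff, mem_singleton_iff, Complex.ofReal_inj] using ht
    refine ht.frequently (Filter.Eventually.frequently ?_)
    filter_upwards [mem_nhdsWithin_of_mem_nhds (isOpen_Ioo.mem_nhds hm)] with t ht using hIoo ht
  have hgz : EqOn g 0 (interior K) :=
    (hgd.analyticOnNhd isOpen_interior).eqOn_zero_of_preconnected_of_frequently_eq_zero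
      hconv.interior.isPreconnected (huvK _ (Ioo_subset_Ioc_self hm)) hfreq
  have h0 : ∫ t in Ioc a b, ‖g (t : ℂ)‖ = 0 := by
    rw [setIntegral_congr_fun (g := fun _ => (0 : ℝ)) measurableSet_Ioc fun t ht => by
      simp [hgz (habK t ht)]]
    simp
  rw [← h0]
  exact hlim habK

lemma dirichletSum_const_mul (a z : ℂ) :
    dirichletSum l (fun j => a * c j) z = a * dirichletSum l c z := by
  simp [dirichletSum, Finset.mul_sum, mul_assoc]

lemma exists_integral_Ioi_exp_le {K β : ℝ} (hβ : 0 < β) (T : ℝ) :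
    ∃ A, T ≤ A ∧ ∫ t in Ioi A, K * Real.exp (-β * t) ≤ 1 / 2 := by
  have h : Filter.Tendsto (fun A : ℝ => K * (-Real.exp (-β * A) / -β)) Filter.atTop (nhds 0) := by
    have h1 : Filter.Tendsto (fun A : ℝ => Real.exp (-β * A)) Filter.atTop (nhds 0) :=
      Real.tendsto_exp_atBot.comp (Filter.tendsto_id.const_mul_atTop_of_neg (by linarith))
    simpa using (h1.neg.div_const (-β)).const_mul K
  obtain ⟨A, hA, hTA⟩ := ((h.eventually_le_const (by norm_num : (0 : ℝ) < 1 / 2)).and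
    (Filter.eventually_ge_atTop T)).exists
  refine ⟨A, hTA, ?_⟩
  rwa [integral_const_mul, integral_exp_mul_Ioi (by linarith)]

lemma norm_dirichletSum_setIntegral_Ioi_eq (hl : ∀ j, 0 < l j) {T A : ℝ} (hT : 0 ≤ T)
    (hTA : T ≤ A) :
    ∫ t in Ioi (0 : ℝ), ‖dirichletSum l c t‖ = (∫ t in Ioc 0 T, ‖dirichletSum l c t‖) +
      (∫ t in Ioc T A, ‖dirichletSum l c t‖) + ∫ t in Ioi A, ‖dirichletSum l c t‖ := by
  have hi : IntegrableOn (fun t : ℝ => ‖dirichletSum l c t‖) (Ioi 0) :=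
    (integrableOn_dirichletSum hl).norm
  have hi' : IntegrableOn (fun t : ℝ => ‖dirichletSum l c t‖) (Ioi T) :=
    hi.mono_set (Ioi_subset_Ioi hT)
  rw [← Ioc_union_Ioi_eq_Ioi hT, setIntegral_union (Ioc_disjoint_Ioi le_rfl) measurableSet_Ioi
    (hi.mono_set Ioc_subset_Ioi_self) hi', ← Ioc_union_Ioi_eq_Ioi hTA,
    setIntegral_union (Ioc_disjoint_Ioi le_rfl) measurableSet_Ioi
    (hi'.mono_set Ioc_subset_Ioi_self) (hi'.mono_set (Ioi_subset_Ioi hTA)), add_assoc]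

end Auxiliary

/-- For every `T ∈ (0,∞)` there is `C > 0`, depending only on `T` and
`Λ`, such that for every Dirichlet polynomial `p` (with exponents in `Λ`):
`∫₀^∞ |p(t)| dt ≤ C ∫₀ᵀ |p(t)| dt`. -/
theorem statement18 (Λ : ℕ → ℝ) (hpos : ∀ j, 0 < Λ j) (hmono : StrictMono Λ)
    (hsum : Summable fun j => 1 / Λ j) (T : ℝ) (hT : 0 < T) :
    ∃ C : ℝ, 0 < C ∧ ∀ p : ℂ → ℂ, IsDirichletPoly Λ p →
      (∫ t in Ioi (0 : ℝ), ‖p (t : ℂ)‖) ≤ C * ∫ t in Ioc (0 : ℝ) T, ‖p (t : ℂ)‖ := by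
  obtain ⟨K, hK0, hK⟩ := exists_norm_dirichletSum_le hpos hmono hsum (x₀ := 2 * T / 5)
    (by positivity)
  have hβ : 0 < Λ 0 / 24 := by have := hpos 0; positivity
  obtain ⟨A, hTA, hA⟩ := exists_integral_Ioi_exp_le (K := K) hβ T
  by_contra! hcon
  have hex : ∀ n : ℕ, ∃ (N : ℕ) (c : Fin N → ℂ),
      (∫ t in Ioi (0 : ℝ), ‖dirichletSum (fun j : Fin N => Λ j) c t‖) = 1 ∧
      (∫ t in Ioc (0 : ℝ) T, ‖dirichletSum (fun j : Fin N => Λ j) c t‖) ≤ 1 / ((n : ℝ) + 1) := by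
    intro n
    obtain ⟨p, ⟨N, c, rfl⟩, hp⟩ := hcon ((n : ℝ) + 1) (by positivity)
    change _ * (∫ t in Ioc (0 : ℝ) T, ‖dirichletSum (fun j : Fin N => Λ j) c t‖) <
      ∫ t in Ioi (0 : ℝ), ‖dirichletSum (fun j : Fin N => Λ j) c t‖ at hp
    set I := ∫ t in Ioi (0 : ℝ), ‖dirichletSum (fun j : Fin N => Λ j) c t‖
    have hI : 0 < I := lt_of_le_of_lt
      (mul_nonneg (by positivity) (integral_nonneg fun _ => norm_nonneg _)) hp
    have hnorm : ‖(I : ℂ)⁻¹‖ = I⁻¹ := by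
      rw [norm_inv, Complex.norm_real, Real.norm_of_nonneg hI.le]
    refine ⟨N, fun j => (I : ℂ)⁻¹ * c j, ?_, ?_⟩
    · simp only [dirichletSum_const_mul, norm_mul, hnorm, integral_const_mul]
      exact inv_mul_cancel₀ hI.ne'
    · simp only [dirichletSum_const_mul, norm_mul, hnorm, integral_const_mul]
      rw [inv_mul_le_iff₀ hI, mul_one_div, le_div_iff₀ (by positivity), mul_comm]
      exact hp.le
  choose N c hc1 hcT using hex
  let f : ℕ → ℂ → ℂ := fun n => dirichletSum (fun j : Fin (N n) => Λ j) (c n)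
  have hbound : ∀ n (z : ℂ), 2 * T / 5 ≤ z.re → |z.im| ≤ z.re / 2 →
      ‖f n z‖ ≤ K * Real.exp (-(Λ 0 / 24) * z.re) := fun n z h1 h2 => by
    simpa [hc1 n] using hK (N n) (c n) z h1 h2
  have hpos' : ∀ n (j : Fin (N n)), 0 < Λ j := fun _ j => hpos j
  have hint : ∀ n, IntegrableOn (fun t : ℝ => ‖f n t‖) (Ioi 0) := fun n =>
    (integrableOn_dirichletSum (hpos' n)).norm
  have htail : ∀ n : ℕ, ∫ t in Ioi A, ‖f n t‖ ≤ 1 / 2 := by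
    intro n
    refine le_trans (setIntegral_mono_on
      ((hint n).mono_set (Ioi_subset_Ioi (by linarith)))
      ((integrableOn_exp_mul_Ioi (by linarith) A).const_mul K) measurableSet_Ioi
      fun t ht => ?_) hA
    have ht' : A < t := ht
    exact hbound n t (by simp; linarith) (by simp; linarith)
  have hmid : ∀ n : ℕ, 1 / 2 - 1 / ((n : ℝ) + 1) ≤ ∫ t in Ioc T A, ‖f n t‖ := by
    intro n
    have h1 := norm_dirichletSum_setIntegral_Ioi_eq (c := c n) (hpos' n) hT.le hTA
    rw [hc1 n] at h1
    have h2 := htail n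
    have h3 := hcT n
    simp only [f] at h2 ⊢
    linarith
  let S : Set ℂ := Icc (T / 2) (A + 1) ×ℂ Icc (-(T / 10)) (T / 10)
  have hSconv : Convex ℝ S :=
    ((convex_Icc (T / 2) (A + 1)).linear_preimage Complex.reLm).inter
      ((convex_Icc (-(T / 10)) (T / 10)).linear_preimage Complex.imLm)
  have hSint : ∀ t : ℝ, T / 2 < t → t < A + 1 → (t : ℂ) ∈ interior S := by
    intro t h1 h2
    rw [Complex.interior_reProdIm, interior_Icc, interior_Icc, Complex.mem_reProdIm]
    refine ⟨⟨h1, h2⟩, ?_, ?_⟩ <;> simp <;> linarith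
  have hM : ∀ n, ∀ x ∈ S, ∀ z ∈ Metric.closedBall x (T / 10), ‖f n z‖ ≤ K := by
    intro n x hx z hz
    obtain ⟨hx1, hx2⟩ := Complex.mem_reProdIm.1 hx
    rw [mem_closedBall_iff_norm] at hz
    have h1 := abs_le.1 ((Complex.abs_re_le_norm _).trans hz)
    have h2 := abs_le.1 ((Complex.abs_im_le_norm _).trans hz)
    rw [Complex.sub_re] at h1
    rw [Complex.sub_im] at h2
    have hre : 2 * T / 5 ≤ z.re := by linarith [h1.1, hx1.1]
    refine (hbound n z hre (abs_le.2 ⟨?_, ?_⟩)).trans (mul_le_of_le_one_right hK0.le ?_)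
    · linarith [h2.1, hx2.1]
    · linarith [h2.2, hx2.2]
    · rw [Real.exp_le_one_iff]
      have : 0 ≤ z.re := le_trans (by positivity) hre
      rw [neg_mul]
      exact neg_nonpos.2 (by positivity)
  have hlim : Filter.Tendsto (fun n : ℕ => 1 / ((n : ℝ) + 1)) Filter.atTop (nhds 0) :=
    tendsto_one_div_add_atTop_nhds_zero_nat
  have hzero : Filter.Tendsto (fun n => ∫ t in Ioc (T / 2) T, ‖f n t‖) Filter.atTop (nhds 0) := by
    refine squeeze_zero (fun n => integral_nonneg fun _ => norm_nonneg _) (fun n => ?_) hlim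
    refine le_trans (setIntegral_mono_set ?_ ?_ ?_) (hcT n)
    · exact (hint n).mono_set Ioc_subset_Ioi_self
    · exact Filter.Eventually.of_forall fun _ => norm_nonneg _
    · exact (Ioc_subset_Ioc_left (by positivity)).eventuallyLE
  obtain ⟨φ, hφ, hφlim⟩ := exists_subseq_tendsto_setIntegral_norm
    (fun n => differentiable_dirichletSum) (isCompact_Icc.reProdIm isCompact_Icc)
    hSconv (by positivity : 0 < T / 10) hM
    (by linarith : T / 2 < T) (fun t ht => hSint t ht.1 (by linarith [ht.2])) hzero
    (a := T) (b := A) (fun t ht => hSint t (by linarith [ht.1]) (by linarith [ht.2]))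
  have hle := le_of_tendsto_of_tendsto' ((hlim.comp hφ.tendsto_atTop).const_sub (1 / 2)) hφlim
    fun n => hmid (φ n)
  norm_num at hle

end DirichletBBP
end
end

section
/- Fix θ₀ ∈ (0,π/2), ε > 0 and T ∈ (0,∞). There exist constants C₁ > 0, depending only on θ₀, ε, T and Λ, and C₂ > 0, depending only on θ₀ and Λ, such that for every Dirichlet polynomial p (with exponents in Λ) and every z ∈ S_{ε,θ₀}: |p(z)| ≤ C₁·e^{−C₂·Re z}·∫₀^T |p(t)| dt. -/
/-!
Setting: `Λ = (λ_j)_{j≥0}` is a strictly increasing sequence of positive reals with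
`Σ 1/λ_j < ∞`.  A Dirichlet polynomial (with exponents in `Λ`) is a finite sum
`p(z) = Σ_{j<N} c_j e^{-λ_j z}`.  For `θ₀ ∈ (0,π/2)` and `ε > 0`, the sector is
`S_{ε,θ₀} = {z = x+iy : x ≥ ε, |y| ≤ (x/2)·cot θ₀}`.
-/

open MeasureTheory Set
open scoped ENNReal

noncomputable section

namespace DirichletBBP

section Contour

lemma exists_primitive_exp_div (z l : ℂ) :
    ∃ F : ℂ → ℂ, ∀ ζ, ζ ≠ l →
      HasDerivAt F ((Complex.exp (-ζ * z) - Complex.exp (-l * z)) / (ζ - l)) ζ := by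
  have hd : Differentiable ℂ (fun ζ : ℂ => Complex.exp (-ζ * z)) := by fun_prop
  have hs : Differentiable ℂ (dslope (fun ζ : ℂ => Complex.exp (-ζ * z)) l) := by
    rw [← differentiableOn_univ, Complex.differentiableOn_dslope Filter.univ_mem]
    exact hd.differentiableOn
  obtain ⟨F, hF⟩ := hs.isExactOn_univ
  refine ⟨F, fun ζ hζ => ?_⟩
  have := hF ζ (mem_univ _)
  rwa [dslope_of_ne _ hζ, slope_def_field] at this

/-- Cauchy's formula for `ζ ↦ exp (-ζ z)` on the triangle with vertices
`v` and `v + r (c ± i b)`. -/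
lemma triangle_cauchy_exp {v l c b r : ℝ} (hv : v < l) (hs : 0 < b) (hr0 : 0 ≤ r)
    (hr : l < v + r * c) (z ω ω' : ℂ) (hω : ω = ⟨c, b⟩)
    (hω' : ω' = ⟨c, -b⟩) :
    (∫ t in (0 : ℝ)..r, Complex.exp (-(v + t * ω) * z) / (v + t * ω - l) * ω) -
      (∫ t in (0 : ℝ)..r, Complex.exp (-(v + t * ω') * z) / (v + t * ω' - l) * ω') -
      (∫ s in (-(r * b))..(r * b),
        Complex.exp (-((v + r * c : ℝ) + s * Complex.I) * z) /
          ((v + r * c : ℝ) + s * Complex.I - l) * Complex.I) =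
      -(2 * Real.pi * Complex.I * Complex.exp (-l * z)) := by
  have hrpos : 0 < r := by
    rcases hr0.lt_or_eq with h | h
    · exact h
    · subst h; linarith
  obtain ⟨F, hF⟩ := exists_primitive_exp_div z l
  set k := Complex.exp (-l * z) with hk
  have h1 : ∀ ζ : ℂ, (l : ℂ) - ζ ∈ Complex.slitPlane →
      HasDerivAt (fun ζ => F ζ + k * Complex.log (l - ζ))
        (Complex.exp (-ζ * z) / (ζ - l)) ζ := by
    intro ζ hζ
    have hne : (l : ℂ) - ζ ≠ 0 := Complex.slitPlane_ne_zero hζ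
    have hne' : ζ - l ≠ 0 := by rw [← neg_sub]; exact neg_ne_zero.2 hne
    have := (hF ζ (sub_ne_zero.1 hne')).add
      ((((hasDerivAt_id' ζ).const_sub (l : ℂ)).clog hζ).const_mul k)
    refine this.congr_deriv ?_
    rw [← neg_sub ζ (l : ℂ)]
    field_simp
    ring
  have h2 : ∀ ζ : ℂ, ζ - l ∈ Complex.slitPlane →
      HasDerivAt (fun ζ => F ζ + k * Complex.log (ζ - l))
        (Complex.exp (-ζ * z) / (ζ - l)) ζ := by
    intro ζ hζ
    have hne' : ζ - l ≠ 0 := Complex.slitPlane_ne_zero hζ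
    have := (hF ζ (sub_ne_zero.1 hne')).add
      ((((hasDerivAt_id' ζ).sub_const (l : ℂ)).clog hζ).const_mul k)
    refine this.congr_deriv ?_
    field_simp
    ring
  have path : ∀ (G : ℂ → ℂ) (S : Set ℂ) (a d : ℂ) (p q : ℝ), p ≤ q →
      (∀ ζ ∈ S, ζ ≠ l) →
      (∀ ζ ∈ S, HasDerivAt G (Complex.exp (-ζ * z) / (ζ - l)) ζ) →
      (∀ t ∈ Icc p q, a + t * d ∈ S) →
      ∫ t in p..q, Complex.exp (-(a + t * d) * z) / (a + t * d - l) * d =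
        G (a + q * d) - G (a + p * d) := by
    intro G S a d p q hpq hS hG hp
    have hγ : ∀ t : ℝ, HasDerivAt (fun t : ℝ => a + t * d) d t := by
      intro t
      simpa using ((Complex.ofRealCLM.hasDerivAt (x := t)).mul_const d).const_add a
    refine intervalIntegral.integral_eq_sub_of_hasDerivAt (f := fun t : ℝ => G (a + t * d)) ?_ ?_
    · intro t ht
      rw [uIcc_of_le hpq] at ht
      exact (hG _ (hp t ht)).comp t (hγ t)
    · apply ContinuousOn.intervalIntegrable
      rw [uIcc_of_le hpq]
      refine ContinuousOn.mul (ContinuousOn.div (by fun_prop) (by fun_prop) ?_) (by fun_prop)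
      intro t ht
      exact sub_ne_zero.2 (hS _ (hp t ht))
  have mem : ∀ ω₀ : ℂ, ω₀.im ≠ 0 → ∀ t ∈ Icc 0 r, (v : ℂ) + (t : ℝ) * ω₀ ∈
      {ζ : ℂ | (l : ℂ) - ζ ∈ Complex.slitPlane} := by
    intro ω₀ h0 t ht
    rw [mem_ofPred_eq, Complex.mem_slitPlane_iff]
    rcases ht.1.lt_or_eq with h | h
    · right
      simp [h.ne', h0]
    · left
      simp [← h, hv]
  have neS : ∀ ζ ∈ {ζ : ℂ | (l : ℂ) - ζ ∈ Complex.slitPlane}, ζ ≠ l := by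
    intro ζ hζ h
    exact Complex.slitPlane_ne_zero hζ (by simp [h])
  rw [path _ _ v ω 0 r hr0 neS h1 (mem ω (by rw [hω]; exact hs.ne')),
    path _ _ v ω' 0 r hr0 neS h1 (mem ω' (by rw [hω']; exact (neg_neg_of_pos hs).ne)),
    path _ {ζ : ℂ | ζ - (l : ℂ) ∈ Complex.slitPlane} (v + r * c : ℝ) Complex.I
      (-(r * b)) (r * b) (by nlinarith [mul_pos hrpos hs])
      (fun ζ hζ h => Complex.slitPlane_ne_zero hζ (by simp [h])) h2 ?_]
  · have e1 : ((v + r * c : ℝ) : ℂ) + (r * b : ℝ) * Complex.I = v + r * ω := by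
      rw [hω]; apply Complex.ext <;> simp
    have e2 : ((v + r * c : ℝ) : ℂ) + (-(r * b) : ℝ) * Complex.I = v + r * ω' := by
      rw [hω']; apply Complex.ext <;> simp
    rw [e1, e2]
    have l1 : Complex.log (l - (v + r * ω)) = Complex.log (v + r * ω - l) - Real.pi * Complex.I := by
      rw [← neg_sub, Complex.log, Complex.log, norm_neg, Complex.arg_neg_eq_arg_sub_pi_of_im_pos]
      · push_cast; ring
      · simp [hω, mul_pos hrpos hs]
    have l2 : Complex.log (l - (v + r * ω')) =
        Complex.log (v + r * ω' - l) + Real.pi * Complex.I := by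
      rw [← neg_sub, Complex.log, Complex.log, norm_neg, Complex.arg_neg_eq_arg_add_pi_of_im_neg]
      · push_cast; ring
      · simp [hω', mul_pos hrpos hs]
    rw [l1, l2]
    simp only [Complex.ofReal_zero, zero_mul, add_zero]
    ring
  · intro t _
    rw [mem_ofPred_eq, Complex.mem_slitPlane_iff]
    left
    simp only [Complex.sub_re, Complex.add_re, Complex.ofReal_re, Complex.mul_re, Complex.I_re,
      Complex.I_im, Complex.ofReal_im]
    linarith

lemma norm_exp_neg_mul_le {v a b t s x : ℝ} {z : ℂ} (hx : x = z.re) (hs : |s| ≤ t * b)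
    (hz : |z.im| * b ≤ z.re * a / 2) (ht : 0 ≤ t) :
    ‖Complex.exp (-((v + t * a : ℝ) + s * Complex.I) * z)‖ ≤
      Real.exp (-v * x) * Real.exp (-(t * (a * x / 2))) := by
  rw [Complex.norm_exp, ← Real.exp_add, Real.exp_le_exp]
  have h1 : s * z.im ≤ t * (z.re * a / 2) := by
    calc s * z.im ≤ |s * z.im| := le_abs_self _
      _ = |s| * |z.im| := abs_mul _ _
      _ ≤ t * b * |z.im| := by gcongr
      _ = t * (|z.im| * b) := by ring
      _ ≤ _ := by gcongr
  subst hx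
  simp only [Complex.mul_re, Complex.neg_re, Complex.add_re, Complex.ofReal_re, Complex.I_re,
    Complex.ofReal_im, Complex.I_im, Complex.neg_im, Complex.add_im, Complex.mul_im]
  nlinarith

lemma tendsto_vertical_side {v l a b : ℝ} (ha : 0 < a) (hb : 0 < b) {z : ℂ} (hx : 0 < z.re)
    (hz : |z.im| * b ≤ z.re * a / 2) :
    Filter.Tendsto (fun r : ℝ => ∫ s in (-(r * b))..(r * b),
        Complex.exp (-((v + r * a : ℝ) + s * Complex.I) * z) /
          ((v + r * a : ℝ) + s * Complex.I - l) * Complex.I) Filter.atTop (nhds 0) := by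
  have hlim : Filter.Tendsto (fun r : ℝ => Real.exp (-v * z.re) * (2 * b) *
      (r ^ (1 : ℝ) * Real.exp (-(a * z.re / 2) * r))) Filter.atTop (nhds 0) := by
    simpa using (tendsto_rpow_mul_exp_neg_mul_atTop_nhds_zero 1 (a * z.re / 2)
      (by positivity)).const_mul (Real.exp (-v * z.re) * (2 * b))
  refine squeeze_zero_norm' ?_ hlim
  filter_upwards [Filter.eventually_ge_atTop ((1 + l - v) / a), Filter.eventually_ge_atTop 0]
    with r hr hr0
  have h1 : 1 ≤ v + r * a - l := by
    rw [div_le_iff₀ ha] at hr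
    linarith
  refine (intervalIntegral.norm_integral_le_of_norm_le_const
    (C := Real.exp (-v * z.re) * Real.exp (-(r * (a * z.re / 2)))) ?_).trans (le_of_eq ?_)
  · intro s hs
    have hrb : 0 ≤ r * b := by positivity
    rw [uIoc_of_le (by linarith)] at hs
    rw [norm_mul, Complex.norm_I, mul_one, norm_div]
    refine (div_le_self (norm_nonneg _) ?_).trans
      (norm_exp_neg_mul_le rfl (abs_le.2 ⟨hs.1.le, hs.2⟩) hz hr0)
    refine h1.trans ?_
    refine le_trans (le_of_eq ?_) (Complex.re_le_norm _)
    simp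
  · rw [Real.rpow_one, show r * b - -(r * b) = 2 * b * r by ring,
      abs_of_nonneg (by positivity)]
    ring_nf

lemma norm_integral_resolvent_le {N : ℕ} {c : Fin N → ℂ} {l : Fin N → ℝ} {v ε δ K a b r : ℝ}
    (hr : 0 ≤ r) (hδ : 0 < δ) (hδε : δ ≤ ε * a / 4) (ha : 0 < a) {z ω : ℂ}
    (hω : ω.re = a) (hωb : |ω.im| ≤ b) (hωn : ‖ω‖ ≤ 1) (hε : ε ≤ z.re)
    (hz : |z.im| * b ≤ z.re * a / 2)
    (hK : ∀ t : ℝ, 0 ≤ t → ‖∑ j, c j / (v + t * ω - l j)‖ ≤ K * Real.exp (δ * t)) :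
    ‖∫ t in (0 : ℝ)..r, ∑ j, c j * (Complex.exp (-(v + t * ω) * z) / (v + t * ω - l j) * ω)‖ ≤
      K / δ * Real.exp (-v * z.re) := by
  have hb : 0 ≤ b := (abs_nonneg _).trans hωb
  have hK0 : 0 ≤ K := by simpa using (norm_nonneg _).trans (hK 0 le_rfl)
  have hint : ∀ t ∈ Ioc 0 r,
      ‖∑ j, c j * (Complex.exp (-(v + t * ω) * z) / (v + t * ω - l j) * ω)‖ ≤
        K * Real.exp (-v * z.re) * Real.exp (-δ * t) := by
    intro t ht
    have e1 : ∑ j, c j * (Complex.exp (-(v + t * ω) * z) / (v + t * ω - l j) * ω) =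
        (∑ j, c j / (v + t * ω - l j)) * (Complex.exp (-(v + t * ω) * z) * ω) := by
      rw [Finset.sum_mul]
      exact Finset.sum_congr rfl fun j _ => by ring
    have e2 : (v : ℂ) + t * ω = (v + t * a : ℝ) + (t * ω.im : ℝ) * Complex.I := by
      rw [← hω]; apply Complex.ext <;> simp
    have h2 : ‖Complex.exp (-(v + t * ω) * z)‖ ≤
        Real.exp (-v * z.re) * Real.exp (-(t * (a * z.re / 2))) := by
      rw [e2]
      refine norm_exp_neg_mul_le rfl ?_ hz ht.1.le
      rw [abs_mul, abs_of_pos ht.1]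
      exact mul_le_mul_of_nonneg_left hωb ht.1.le
    rw [e1, norm_mul, norm_mul]
    calc _ ≤ K * Real.exp (δ * t) *
          (Real.exp (-v * z.re) * Real.exp (-(t * (a * z.re / 2))) * 1) := by
            gcongr
            exact hK t ht.1.le
      _ = K * Real.exp (-v * z.re) * Real.exp (δ * t + -(t * (a * z.re / 2))) := by
            rw [Real.exp_add]; ring
      _ ≤ _ := by
            gcongr
            have : δ * 2 ≤ a * z.re / 2 := by nlinarith
            nlinarith [ht.1]
  have hI : ∫ t in (0 : ℝ)..r, Real.exp (-δ * t) = (1 - Real.exp (-δ * r)) / δ := by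
    rw [intervalIntegral.integral_comp_mul_left (fun x => Real.exp x) (neg_ne_zero.2 hδ.ne'),
      integral_exp]
    simp
    field_simp
    ring
  refine (intervalIntegral.norm_integral_le_of_norm_le hr (Filter.Eventually.of_forall hint)
    (Continuous.intervalIntegrable (by fun_prop) _ _)).trans ?_
  rw [intervalIntegral.integral_const_mul, hI]
  calc _ = K / δ * Real.exp (-v * z.re) * (1 - Real.exp (-δ * r)) := by ring
    _ ≤ K / δ * Real.exp (-v * z.re) * 1 := by
      gcongr
      linarith [Real.exp_pos (-δ * r)]
    _ = _ := mul_one _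

/-- An exponential sum is controlled by its resolvent sum on the boundary of a sector. -/
lemma norm_expSum_le_of_resolvent_bound {N : ℕ} {c : Fin N → ℂ} {l : Fin N → ℝ}
    {v ε δ K a b : ℝ} (hv : ∀ j, v < l j) (hε0 : 0 < ε) (hδ : 0 < δ) (hδε : δ ≤ ε * a / 4)
    (ha : 0 < a) (hb : 0 < b) (hab : a ^ 2 + b ^ 2 = 1) {z : ℂ} (hε : ε ≤ z.re)
    (hz : |z.im| * b ≤ z.re * a / 2)
    (hK : ∀ ω : ℂ, ω.re = a → |ω.im| = b → ∀ t : ℝ, 0 ≤ t →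
      ‖∑ j, c j / (v + t * ω - l j)‖ ≤ K * Real.exp (δ * t)) :
    ‖∑ j, c j * Complex.exp (-(l j : ℂ) * z)‖ ≤ K / δ * Real.exp (-v * z.re) := by
  set ω : ℂ := ⟨a, b⟩ with hω
  set ω' : ℂ := ⟨a, -b⟩ with hω'
  set V : Fin N → ℝ → ℂ := fun j r => ∫ s in (-(r * b))..(r * b),
        Complex.exp (-((v + r * a : ℝ) + s * Complex.I) * z) /
          ((v + r * a : ℝ) + s * Complex.I - l j) * Complex.I with hV
  have hnorm : ∀ w : ℂ, w.re = a → |w.im| = b → ‖w‖ ≤ 1 := by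
    intro w h1 h2
    rw [Complex.norm_def, Complex.normSq_apply, h1, ← abs_mul_abs_self w.im, h2]
    rw [show a * a + b * b = 1 by nlinarith]
    simp
  have hbound : ∀ w : ℂ, w.re = a → |w.im| = b → ∀ r : ℝ, 0 ≤ r →
      ‖∫ t in (0 : ℝ)..r, ∑ j, c j * (Complex.exp (-(v + t * w) * z) / (v + t * w - l j) * w)‖ ≤
      K / δ * Real.exp (-v * z.re) := fun w h1 h2 r hr =>
    norm_integral_resolvent_le hr hδ hδε ha h1 h2.le (hnorm w h1 h2) hε hz (hK w h1 h2)
  have hexch : ∀ w : ℂ, w.re = a → |w.im| = b → ∀ r : ℝ, 0 ≤ r →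
      ∫ t in (0 : ℝ)..r, ∑ j, c j * (Complex.exp (-(v + t * w) * z) / (v + t * w - l j) * w) =
      ∑ j, c j * ∫ t in (0 : ℝ)..r, Complex.exp (-(v + t * w) * z) / (v + t * w - l j) * w := by
    intro w h1 h2 r hr
    rw [intervalIntegral.integral_finsetSum]
    · simp only [intervalIntegral.integral_const_mul]
    · intro j _
      apply ContinuousOn.intervalIntegrable
      refine ContinuousOn.mul (by fun_prop) (ContinuousOn.mul
        (ContinuousOn.div (by fun_prop) (by fun_prop) ?_) (by fun_prop))
      intro t ht h0
      rw [uIcc_of_le hr] at ht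
      have him := congrArg Complex.im h0
      have hre := congrArg Complex.re h0
      simp [h1] at him hre
      rcases him with h | h
      · rw [h] at hre; linarith [hv j]
      · rw [h] at h2; simp at h2; linarith
  have h2 : |ω.im| = b := abs_of_pos hb
  have h2' : |ω'.im| = b := by rw [hω', abs_neg, abs_of_pos hb]
  have hev : ∀ᶠ r : ℝ in Filter.atTop, 2 * Real.pi *
      ‖∑ j, c j * Complex.exp (-(l j : ℂ) * z)‖ ≤
      2 * (K / δ * Real.exp (-v * z.re)) + ‖∑ j, c j * V j r‖ := by
    have hlarge : ∀ᶠ r : ℝ in Filter.atTop, ∀ j, l j < v + r * a := by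
      rw [Filter.eventually_all]
      intro j
      filter_upwards [Filter.eventually_gt_atTop ((l j - v) / a)] with r hr
      rw [div_lt_iff₀ ha] at hr
      linarith
    filter_upwards [hlarge, Filter.eventually_ge_atTop 0] with r hr hr0
    have hsum : 2 * Real.pi * Complex.I * ∑ j, c j * Complex.exp (-(l j : ℂ) * z) =
        -((∫ t in (0 : ℝ)..r,
          ∑ j, c j * (Complex.exp (-(v + t * ω) * z) / (v + t * ω - l j) * ω)) -
        (∫ t in (0 : ℝ)..r,
          ∑ j, c j * (Complex.exp (-(v + t * ω') * z) / (v + t * ω' - l j) * ω')) -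
        ∑ j, c j * V j r) := by
      rw [hexch ω rfl h2 r hr0, hexch ω' rfl h2' r hr0, ← Finset.sum_sub_distrib,
        ← Finset.sum_sub_distrib, Finset.mul_sum, ← Finset.sum_neg_distrib]
      refine Finset.sum_congr rfl fun j _ => ?_
      have := triangle_cauchy_exp (hv j) hb hr0 (hr j) z ω ω' hω hω'
      rw [← mul_sub, ← mul_sub, this]
      ring
    have hn := congrArg norm hsum
    rw [norm_mul, norm_neg] at hn
    have hpi : ‖2 * (Real.pi : ℂ) * Complex.I‖ = 2 * Real.pi := by
      simp [abs_of_pos Real.pi_pos]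
    rw [hpi] at hn
    rw [hn]
    refine (norm_sub_le _ _).trans ?_
    gcongr
    refine (norm_sub_le _ _).trans ?_
    linarith [hbound ω rfl h2 r hr0, hbound ω' rfl h2' r hr0]
  have hlim : Filter.Tendsto (fun r : ℝ => 2 * (K / δ * Real.exp (-v * z.re)) +
      ‖∑ j, c j * V j r‖) Filter.atTop (nhds (2 * (K / δ * Real.exp (-v * z.re)))) := by
    have : Filter.Tendsto (fun r : ℝ => ∑ j, c j * V j r) Filter.atTop (nhds 0) := by
      rw [show (0 : ℂ) = ∑ j : Fin N, c j * 0 by simp]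
      exact tendsto_finsetSum _ fun j _ =>
        (tendsto_vertical_side ha hb (hε0.trans_le hε) hz).const_mul _
    simpa using this.norm.const_add (2 * (K / δ * Real.exp (-v * z.re)))
  have := ge_of_tendsto hlim hev
  nlinarith [Real.pi_gt_three, norm_nonneg (∑ j, c j * Complex.exp (-(l j : ℂ) * z))]

end Contour
section Hilbert
variable {E : Type*} [NormedAddCommGroup E] [InnerProductSpace ℂ E]

/-- The average `(1 + U) / 2` of the identity and a linear isometry `U`. -/
def halfSum (U : E →ₗᵢ[ℂ] E) : E →ₗ[ℂ] E := (1 / 2 : ℂ) • (LinearMap.id + U.toLinearMap)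

lemma halfSum_apply (U : E →ₗᵢ[ℂ] E) (g : E) : halfSum U g = (1 / 2 : ℂ) • (g + U g) := rfl

lemma norm_isometry_sub_self_sq (U : E →ₗᵢ[ℂ] E) (g : E) :
    ‖U g - g‖ ^ 2 = 4 * (‖g‖ ^ 2 - ‖halfSum U g‖ ^ 2) := by
  have h := parallelogram_law_with_norm ℂ (U g) g
  have h2 : ‖halfSum U g‖ = (1 / 2) * ‖U g + g‖ := by
    rw [halfSum_apply, norm_smul, add_comm]; norm_num
  rw [h2]
  rw [U.norm_map] at h
  nlinarith

lemma norm_halfSum_le (U : E →ₗᵢ[ℂ] E) (g : E) : ‖halfSum U g‖ ≤ ‖g‖ := by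
  have h := norm_isometry_sub_self_sq U g
  have : ‖halfSum U g‖ ^ 2 ≤ ‖g‖ ^ 2 := by nlinarith [sq_nonneg ‖U g - g‖]
  exact le_of_sq_le_sq this (norm_nonneg _)

lemma norm_isometry_sub_smul_sq (U : E →ₗᵢ[ℂ] E) (x : ℝ) (g : E) :
    ‖U g - (x : ℂ) • g‖ ^ 2 = (1 - x) ^ 2 * ‖g‖ ^ 2 + x * ‖U g - g‖ ^ 2 := by
  rw [norm_sub_sq (𝕜 := ℂ), norm_sub_sq (𝕜 := ℂ), inner_smul_right, norm_smul, U.norm_map]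
  simp [mul_pow]
  ring

lemma isometry_sub_self_halfSum (U : E →ₗᵢ[ℂ] E) (g : E) :
    U (halfSum U g) - halfSum U g = halfSum U (U g - g) := by
  simp only [halfSum_apply, map_smul, map_add, map_sub, ← smul_sub]

lemma norm_isometry_sub_smul_halfSum_pow_le (U : E →ₗᵢ[ℂ] E) {x : ℝ} (hx1 : x ≤ 1)
    {m : ℕ} (hm : 4 * x ≤ m * (1 - x) ^ 2) (f : E) :
    ‖U ((halfSum U ^ m) f) - (x : ℂ) • (halfSum U ^ m) f‖ ≤ (1 - x) * ‖f‖ := by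
  set d : ℕ → ℝ := fun k => ‖(halfSum U ^ k) f‖ ^ 2 with hd
  set e : ℕ → ℝ := fun k => ‖U ((halfSum U ^ k) f) - (halfSum U ^ k) f‖ ^ 2 with he
  have hde : ∀ k, e k = 4 * (d k - d (k + 1)) := by
    intro k
    simp only [hd, he, pow_succ' (halfSum U), Module.End.mul_apply]
    exact norm_isometry_sub_self_sq U _
  have hanti : Antitone e := by
    refine antitone_nat_of_succ_le fun k => ?_
    simp only [he, pow_succ' (halfSum U), Module.End.mul_apply]
    rw [isometry_sub_self_halfSum]
    gcongr
    exact norm_halfSum_le _ _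
  have hsum : (m : ℝ) * e m ≤ 4 * (d 0 - d m) := by
    have h1 : ∑ k ∈ Finset.range m, e k = 4 * (d 0 - d m) := by
      simp only [hde, ← Finset.mul_sum, Finset.sum_range_sub']
    have h2 : ∑ _k ∈ Finset.range m, e m ≤ ∑ k ∈ Finset.range m, e k :=
      Finset.sum_le_sum fun k hk => hanti (Finset.mem_range.1 hk).le
    simpa [h1] using h2
  have hem : 0 ≤ e m := by positivity
  have key : ‖U ((halfSum U ^ m) f) - (x : ℂ) • (halfSum U ^ m) f‖ ^ 2 ≤ ((1 - x) * ‖f‖) ^ 2 := by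
    rw [norm_isometry_sub_smul_sq]
    change (1 - x) ^ 2 * d m + x * e m ≤ _
    have h0 : d 0 = ‖f‖ ^ 2 := by simp [hd]
    rw [mul_pow, ← h0]
    have := mul_le_mul_of_nonneg_right hm hem
    nlinarith [mul_le_mul_of_nonneg_left hsum (sq_nonneg (1 - x))]
  exact le_of_sq_le_sq key (mul_nonneg (by linarith) (norm_nonneg _))
end Hilbert

section Shift

/-- Translation `f ↦ f (· + a)` as a linear isometry of `L²(ℝ)`. -/
def shift (a : ℝ) : Lp ℂ 2 (volume : Measure ℝ) →ₗᵢ[ℂ] Lp ℂ 2 (volume : Measure ℝ) :=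
  Lp.compMeasurePreservingₗᵢ ℂ (fun t => t + a) (measurePreserving_add_right volume a)

/-- `f` coincides almost everywhere with `q` on `[0, A]`. -/
def AgreesOn (f : Lp ℂ 2 (volume : Measure ℝ)) (A : ℝ) (q : ℝ → ℂ) : Prop :=
  ∀ᵐ t, t ∈ Icc 0 A → f t = q t

/-- The exponential sum with frequencies `σ` and coefficients `d`. -/
def expSum {ι : Type} [Fintype ι] (σ d : ι → ℂ) (t : ℝ) : ℂ :=
  ∑ i, d i * Complex.exp (-σ i * t)

variable {f g : Lp ℂ 2 (volume : Measure ℝ)} {A B a : ℝ} {q r : ℝ → ℂ}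

lemma AgreesOn.mono (h : AgreesOn f A q) (hB : B ≤ A) : AgreesOn f B q := by
  filter_upwards [h] with t ht htB using ht ⟨htB.1, htB.2.trans hB⟩

lemma AgreesOn.congr (h : AgreesOn f A q) (hqr : ∀ t, q t = r t) : AgreesOn f A r := by
  rwa [← funext hqr]

lemma AgreesOn.add (hf : AgreesOn f A q) (hg : AgreesOn g A r) :
    AgreesOn (f + g) A (fun t => q t + r t) := by
  filter_upwards [hf, hg, Lp.coeFn_add f g] with t h1 h2 h3 ht
  rw [h3, Pi.add_apply, h1 ht, h2 ht]

lemma AgreesOn.sub (hf : AgreesOn f A q) (hg : AgreesOn g A r) :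
    AgreesOn (f - g) A (fun t => q t - r t) := by
  filter_upwards [hf, hg, Lp.coeFn_sub f g] with t h1 h2 h3 ht
  rw [h3, Pi.sub_apply, h1 ht, h2 ht]

lemma AgreesOn.smul (hf : AgreesOn f A q) (c : ℂ) :
    AgreesOn (c • f) A (fun t => c * q t) := by
  filter_upwards [hf, Lp.coeFn_smul c f] with t h1 h3 ht
  rw [h3, Pi.smul_apply, h1 ht, smul_eq_mul]

lemma AgreesOn.shift (hf : AgreesOn f (A + a) q) (ha : 0 ≤ a) :
    AgreesOn (shift a f) A (fun t => q (t + a)) := by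
  have hmp := measurePreserving_add_right (volume : Measure ℝ) a
  have h1 : DirichletBBP.shift a f =ᵐ[volume] f ∘ fun t => t + a :=
    Lp.coeFn_compMeasurePreserving f hmp
  filter_upwards [h1, hmp.quasiMeasurePreserving.ae hf] with t h2 h3 ht
  rw [h2]
  exact h3 ⟨by linarith [ht.1], by linarith [ht.2]⟩

variable {ι : Type} [Fintype ι] {σ d : ι → ℂ}

lemma expSum_add (a t : ℝ) :
    expSum σ d (t + a) = expSum σ (fun i => d i * Complex.exp (-σ i * a)) t := by
  refine Finset.sum_congr rfl fun i _ => ?_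
  rw [mul_assoc, ← Complex.exp_add]
  push_cast
  ring_nf

lemma AgreesOn.halfSum_shift (hf : AgreesOn f (A + a) (expSum σ d)) (ha : 0 ≤ a) :
    AgreesOn (halfSum (DirichletBBP.shift a) f) A
      (expSum σ fun i => d i * ((1 + Complex.exp (-σ i * a)) / 2)) := by
  refine (((hf.mono (by linarith)).add (hf.shift ha)).smul (1 / 2)).congr fun t => ?_
  rw [expSum_add]
  simp only [expSum, ← Finset.sum_add_distrib, Finset.mul_sum]
  exact Finset.sum_congr rfl fun i _ => by ring

lemma AgreesOn.halfSum_shift_pow (ha : 0 ≤ a) (m : ℕ) : ∀ {A : ℝ},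
    AgreesOn f (A + m * a) (expSum σ d) →
    AgreesOn ((halfSum (DirichletBBP.shift a) ^ m) f) A
      (expSum σ fun i => d i * ((1 + Complex.exp (-σ i * a)) / 2) ^ m) := by
  induction m with
  | zero => intro A hf; simpa using hf
  | succ m ih =>
    intro A hf
    rw [pow_succ', Module.End.mul_apply]
    have := ih (A := A + a) (by convert hf using 1; push_cast; ring)
    refine (this.halfSum_shift ha).congr fun t => ?_
    simp only [pow_succ, mul_assoc]

/-- The function `φ` is the symbol of an operator which shortens intervals by `L` and has norm at
most `K`, and which multiplies each `exp (-σ t)` by `φ σ`. -/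
def IsMultiplier (L K : ℝ) (φ : ℂ → ℂ) : Prop :=
  ∀ (ι : Type) (_ : Fintype ι) (σ d : ι → ℂ) (A : ℝ) (f : Lp ℂ 2 (volume : Measure ℝ)),
    AgreesOn f (A + L) (expSum σ d) →
      ∃ g : Lp ℂ 2 (volume : Measure ℝ), ‖g‖ ≤ K * ‖f‖ ∧
        AgreesOn g A (expSum σ fun i => d i * φ (σ i))

lemma isMultiplier_one : IsMultiplier 0 1 (fun _ => 1) := by
  intro ι _ σ d A f hf
  exact ⟨f, by simp, by simpa using hf⟩

lemma IsMultiplier.mul {L L' K K' : ℝ} {φ ψ : ℂ → ℂ} (hφ : IsMultiplier L K φ)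
    (hψ : IsMultiplier L' K' ψ) (hK' : 0 ≤ K') :
    IsMultiplier (L + L') (K * K') (fun s => φ s * ψ s) := by
  intro ι _ σ d A f hf
  obtain ⟨g, hg, hga⟩ := hφ ι _ σ d (A + L') f (by convert hf using 1; ring)
  obtain ⟨h, hh, hha⟩ := hψ ι _ σ _ A g hga
  refine ⟨h, ?_, hha.congr fun t => by simp only [mul_assoc]⟩
  calc ‖h‖ ≤ K' * ‖g‖ := hh
    _ ≤ K' * (K * ‖f‖) := by gcongr
    _ = _ := by ring

lemma IsMultiplier.prod {α : Type*} (s : Finset α) {L K : α → ℝ} {φ : α → ℂ → ℂ}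
    (h : ∀ j, IsMultiplier (L j) (K j) (φ j)) (hK : ∀ j, 0 ≤ K j) :
    IsMultiplier (∑ j ∈ s, L j) (∏ j ∈ s, K j) (fun z => ∏ j ∈ s, φ j z) := by
  classical
  induction s using Finset.induction_on with
  | empty => simpa using isMultiplier_one
  | insert j s hj ih =>
    simp only [Finset.sum_insert hj, Finset.prod_insert hj]
    exact (h j).mul ih (Finset.prod_nonneg fun i _ => hK i)

/-- The normalised factor with a zero at `1`; see `isMultiplier_blockFactor`. -/
def blockFactor (b : ℝ) (m : ℕ) (w : ℂ) : ℂ :=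
  (Complex.exp (-(b * w)) - Real.exp (-b)) / (1 - Real.exp (-b) : ℝ) *
    ((1 + Complex.exp (-(b * w))) / 2) ^ m

lemma blockFactor_one (b : ℝ) (m : ℕ) : blockFactor b m 1 = 0 := by
  simp [blockFactor]

lemma isMultiplier_of_norm_le {b l K : ℝ} (hb : 0 < b) (hl : 0 < l) (m : ℕ)
    (hK : ∀ f, ‖DirichletBBP.shift (b / l) ((halfSum (DirichletBBP.shift (b / l)) ^ m) f) -
      (Real.exp (-b) : ℂ) • (halfSum (DirichletBBP.shift (b / l)) ^ m) f‖ ≤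
        K * (1 - Real.exp (-b)) * ‖f‖) :
    IsMultiplier ((m + 1) * (b / l)) K (fun s => blockFactor b m (s / l)) := by
  have hx : 0 < 1 - Real.exp (-b) := by
    have : Real.exp (-b) < 1 := by simpa using hb
    linarith
  have ha : 0 ≤ b / l := by positivity
  intro ι _ σ d A f hf
  have h1 := AgreesOn.halfSum_shift_pow (A := A + b / l) ha m
    (f := f) (σ := σ) (d := d) (by convert hf using 1; ring)
  refine ⟨((1 - Real.exp (-b) : ℝ) : ℂ)⁻¹ •
    (DirichletBBP.shift (b / l) ((halfSum (DirichletBBP.shift (b / l)) ^ m) f) -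
      (Real.exp (-b) : ℂ) • (halfSum (DirichletBBP.shift (b / l)) ^ m) f), ?_, ?_⟩
  · rw [norm_smul, norm_inv, Complex.norm_real, Real.norm_of_nonneg hx.le, inv_mul_le_iff₀ hx]
    refine (hK f).trans (le_of_eq (by ring))
  · refine (((h1.shift ha).sub ((h1.mono (by linarith)).smul _)).smul _).congr fun t => ?_
    rw [expSum_add]
    simp only [expSum, Finset.mul_sum, ← Finset.sum_sub_distrib]
    refine Finset.sum_congr rfl fun i _ => ?_
    have e : -σ i * ((b / l : ℝ) : ℂ) = -(b * (σ i / l)) := by push_cast; ring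
    rw [e, blockFactor, div_eq_mul_inv _ ((1 - Real.exp (-b) : ℝ) : ℂ)]
    ring

lemma isMultiplier_blockFactor_zero {b l : ℝ} (hb : 0 < b) (hl : 0 < l) :
    IsMultiplier (b / l) (2 / (1 - Real.exp (-b))) (fun s => blockFactor b 0 (s / l)) := by
  have hx1 : Real.exp (-b) < 1 := by simpa using hb
  have hx : 0 < 1 - Real.exp (-b) := by linarith
  have := isMultiplier_of_norm_le (K := 2 / (1 - Real.exp (-b))) hb hl 0 fun f => by
    rw [pow_zero, Module.End.one_apply, div_mul_cancel₀ _ hx.ne']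
    refine (norm_sub_le _ _).trans ?_
    rw [LinearIsometry.norm_map, norm_smul, Complex.norm_real, Real.norm_of_nonneg
      (Real.exp_pos _).le]
    nlinarith [norm_nonneg f]
  simpa using this

lemma isMultiplier_blockFactor {b l : ℝ} (hb : 0 < b) (hl : 0 < l) {m : ℕ}
    (hm : 4 * Real.exp (-b) ≤ m * (1 - Real.exp (-b)) ^ 2) :
    IsMultiplier ((m + 1) * (b / l)) 1 (fun s => blockFactor b m (s / l)) := by
  have hx1 : Real.exp (-b) < 1 := by simpa using hb
  refine isMultiplier_of_norm_le hb hl m fun f => ?_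
  rw [one_mul]
  exact norm_isometry_sub_smul_halfSum_pow_le _ hx1.le hm f

end Shift

section Resolvent

lemma norm_mul_sqrt_le_of_agreesOn {g : Lp ℂ 2 (volume : Measure ℝ)} {τ : ℝ} {k ζ : ℂ}
    (hζ : 0 ≤ ζ.re) (hg : AgreesOn g τ fun t => k * Complex.exp (-ζ * t)) :
    ‖k‖ * Real.exp (-(τ * ζ.re)) * √τ ≤ ‖g‖ := by
  have hfin : volume (Icc 0 τ) ≠ ⊤ := by simp
  have h := norm_indicatorConstLp (p := 2) (hs := measurableSet_Icc) (hμs := hfin)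
    (c := (‖k‖ * Real.exp (-(τ * ζ.re)) : ℝ)) (by simp) (by simp)
  rcases le_or_gt τ 0 with hτ | hτ
  · simp [Real.sqrt_eq_zero'.2 hτ]
  have h' : ‖indicatorConstLp 2 (measurableSet_Icc (a := (0 : ℝ)) (b := τ)) hfin
      (‖k‖ * Real.exp (-(τ * ζ.re)) : ℝ)‖ = ‖k‖ * Real.exp (-(τ * ζ.re)) * √τ := by
    rw [h, Real.norm_of_nonneg (by positivity), Real.sqrt_eq_rpow]
    simp [hτ.le]
  rw [← h']
  refine Lp.norm_le_norm_of_ae_le ?_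
  filter_upwards [hg, indicatorConstLp_coeFn (p := 2) (hs := measurableSet_Icc (a := (0 : ℝ))
    (b := τ)) (hμs := hfin) (c := (‖k‖ * Real.exp (-(τ * ζ.re)) : ℝ))] with t h1 h2
  rw [h2]
  by_cases ht : t ∈ Icc 0 τ
  · rw [indicator_of_mem ht, h1 ht, Real.norm_of_nonneg (by positivity), norm_mul, Complex.norm_exp]
    gcongr
    simp
    nlinarith [ht.2]
  · simp [ht]

lemma exists_agreesOn_of_norm_le {q : ℝ → ℂ} (hq : Continuous q) {T M : ℝ} (hT : 0 ≤ T)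
    (hM : ∀ t ∈ Icc 0 T, ‖q t‖ ≤ M) :
    ∃ f : Lp ℂ 2 (volume : Measure ℝ), ‖f‖ ≤ M * √T ∧ AgreesOn f T q := by
  have hM0 : 0 ≤ M := (norm_nonneg _).trans (hM 0 ⟨le_rfl, hT⟩)
  have hfin : volume (Icc 0 T) ≠ ⊤ := by simp
  have hconst := memLp_indicator_const (p := 2) (s := Icc 0 T) measurableSet_Icc M (μ := volume)
    (Or.inr hfin)
  have hle : ∀ t, ‖(Icc 0 T).indicator q t‖ ≤ ‖(Icc 0 T).indicator (fun _ => M) t‖ := by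
    intro t
    by_cases ht : t ∈ Icc 0 T
    · rw [indicator_of_mem ht, indicator_of_mem ht, Real.norm_of_nonneg hM0]
      exact hM t ht
    · simp [ht]
  have hmem : MemLp ((Icc 0 T).indicator q) 2 volume :=
    hconst.mono (hq.measurable.indicator measurableSet_Icc).aestronglyMeasurable
      (Filter.Eventually.of_forall hle)
  refine ⟨hmem.toLp _, ?_, ?_⟩
  · have h' : ‖indicatorConstLp 2 (measurableSet_Icc (a := (0 : ℝ)) (b := T)) hfin M‖ =
        M * √T := by
      rw [norm_indicatorConstLp (by simp) (by simp), Real.norm_of_nonneg hM0, Real.sqrt_eq_rpow]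
      simp [hT]
    rw [← h']
    refine Lp.norm_le_norm_of_ae_le ?_
    filter_upwards [hmem.coeFn_toLp, indicatorConstLp_coeFn (p := 2)
      (hs := measurableSet_Icc (a := (0 : ℝ)) (b := T)) (hμs := hfin) (c := M)] with t h1 h2
    rw [h1, h2]
    exact hle t
  · filter_upwards [hmem.coeFn_toLp] with t h1 ht
    rw [h1, indicator_of_mem ht]

variable {N : ℕ} {c : Fin N → ℂ} {l : Fin N → ℝ} {T : ℝ} {ζ : ℂ}

lemma norm_duhamel_le (hζ : 0 ≤ ζ.re) (hζl : ∀ j, ζ ≠ l j) {t : ℝ} (ht : t ∈ Icc 0 T) :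
    ‖∑ j, c j / (ζ - l j) * (Complex.exp (-(l j) * t) - Complex.exp (-ζ * t))‖ ≤
      ∫ u in Ioc (0 : ℝ) T, ‖∑ j, c j * Complex.exp (-(l j : ℂ) * u)‖ := by
  have hFTC : ∀ j, ∫ u in (0 : ℝ)..t, Complex.exp (-(l j) * u - ζ * (t - u)) =
      (Complex.exp (-(l j) * t) - Complex.exp (-ζ * t)) / (ζ - l j) := by
    intro j
    have hne : ζ - l j ≠ 0 := sub_ne_zero.2 (hζl j)
    have hd : ∀ u : ℝ, HasDerivAt
        (fun u : ℝ => Complex.exp (-(l j) * u - ζ * (t - u)) / (ζ - l j))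
        (Complex.exp (-(l j) * u - ζ * (t - u))) u := by
      intro u
      have h0 : HasDerivAt (fun u : ℝ => (u : ℂ)) 1 u := Complex.ofRealCLM.hasDerivAt
      have h1 := (((h0.const_mul (-(l j : ℂ))).sub
        ((h0.const_sub (t : ℂ)).const_mul ζ)).cexp).div_const (ζ - l j)
      refine h1.congr_deriv ?_
      simp only [Pi.sub_apply]
      field_simp
      ring
    rw [intervalIntegral.integral_eq_sub_of_hasDerivAt (fun u _ => hd u)
      (Continuous.intervalIntegrable (by fun_prop) _ _), ← sub_div]
    simp
  have hEq : ∑ j, c j / (ζ - l j) * (Complex.exp (-(l j) * t) - Complex.exp (-ζ * t)) =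
      ∫ u in (0 : ℝ)..t,
        (∑ j, c j * Complex.exp (-(l j : ℂ) * u)) * Complex.exp (-ζ * (t - u)) := by
    simp only [Finset.sum_mul]
    rw [intervalIntegral.integral_finsetSum
      fun j _ => Continuous.intervalIntegrable (by fun_prop) _ _]
    refine Finset.sum_congr rfl fun j _ => ?_
    rw [div_mul_eq_mul_div, mul_div_assoc, ← hFTC, ← intervalIntegral.integral_const_mul]
    congr 1
    ext u
    rw [mul_assoc, ← Complex.exp_add]
    ring_nf
  have hcont : Continuous fun u : ℝ => ‖∑ j, c j * Complex.exp (-(l j : ℂ) * u)‖ := by fun_prop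
  rw [hEq]
  refine (intervalIntegral.norm_integral_le_of_norm_le
    (g := fun u : ℝ => ‖∑ j, c j * Complex.exp (-(l j : ℂ) * u)‖) ht.1
    (Filter.Eventually.of_forall fun u hu => ?_) (hcont.intervalIntegrable _ _)).trans ?_
  · rw [norm_mul]
    refine mul_le_of_le_one_right (norm_nonneg _) ?_
    rw [Complex.norm_exp, Real.exp_le_one_iff]
    have : (-ζ * (t - u)).re = -(ζ.re * (t - u)) := by simp
    rw [this]
    nlinarith [hu.2]
  · rw [intervalIntegral.integral_of_le ht.1]
    exact setIntegral_mono_set (hcont.integrableOn_Ioc)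
      (Filter.Eventually.of_forall fun _ => norm_nonneg _)
      (LE.le.eventuallyLE (Ioc_subset_Ioc_right ht.2))

/-- A multiplier vanishing at all frequencies of an exponential sum controls its resolvent sum. -/
lemma IsMultiplier.norm_resolvent_le {L K τ : ℝ} {H : ℂ → ℂ} (hH : IsMultiplier L K H)
    (hK : 0 ≤ K) (hT : 0 ≤ T) (hLT : τ + L ≤ T) (hHl : ∀ j, H (l j) = 0)
    (hζ : 0 ≤ ζ.re) (hζl : ∀ j, ζ ≠ l j) :
    ‖∑ j, c j / (ζ - l j)‖ * ‖H ζ‖ * Real.exp (-(τ * ζ.re)) * √τ ≤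
      K * ((∫ u in Ioc (0 : ℝ) T, ‖∑ j, c j * Complex.exp (-(l j : ℂ) * u)‖) * √T) := by
  set σ : Option (Fin N) → ℂ := fun o => o.elim ζ (fun j => l j) with hσ
  set d : Option (Fin N) → ℂ := fun o => o.elim (-∑ j, c j / (ζ - l j))
    (fun j => c j / (ζ - l j)) with hd
  have hQ : ∀ t : ℝ, ∑ j, c j / (ζ - l j) * (Complex.exp (-(l j) * t) - Complex.exp (-ζ * t)) =
      expSum σ d t := by
    intro t
    rw [expSum, Fintype.sum_option]
    simp only [hσ, hd, Option.elim, mul_sub, Finset.sum_sub_distrib, ← Finset.sum_mul]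
    ring
  obtain ⟨f, hf, hfa⟩ := exists_agreesOn_of_norm_le (q := expSum σ d)
    (by unfold expSum; fun_prop) hT
    (fun t ht => by rw [← hQ]; exact norm_duhamel_le (c := c) hζ hζl ht)
  obtain ⟨g, hg, hga⟩ := hH _ _ σ d (T - L) f (by simpa using hfa)
  have hk := norm_mul_sqrt_le_of_agreesOn (τ := τ) (k := -(∑ j, c j / (ζ - l j)) * H ζ) hζ
    ((hga.mono (by linarith)).congr fun t => by
      rw [expSum, Fintype.sum_option]
      simp [hσ, hd, hHl])
  rw [norm_mul, norm_neg] at hk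
  refine hk.trans (hg.trans ?_)
  gcongr

end Resolvent

section LowerBound

lemma exists_exp_neg_mul_le {c M : ℝ} (hc : 0 < c) (hM : 0 < M) :
    ∃ C : ℝ, 0 < C ∧ ∀ q t : ℝ, 0 ≤ t → c ≤ q → 1 - M * t ≤ q → Real.exp (-(C * t)) ≤ q := by
  refine ⟨2 * M + 2 * M * |Real.log c|, by positivity, fun q t ht hq hqt => ?_⟩
  have h0 : 0 ≤ |Real.log c| := abs_nonneg _
  rcases le_total (M * t) (1 / 2) with h | h
  · refine le_trans ?_ hqt
    have h1 : Real.exp (-((2 * M + 2 * M * |Real.log c|) * t)) ≤ Real.exp (-(2 * M * t)) := by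
      gcongr
      nlinarith [mul_nonneg hM.le h0]
    refine h1.trans ?_
    have h2 := Real.add_one_le_exp (2 * M * t)
    have hMt : 0 ≤ M * t := by positivity
    rw [Real.exp_neg, inv_le_comm₀ (Real.exp_pos _) (by linarith)]
    refine le_trans ?_ h2
    rw [inv_le_iff_one_le_mul₀ (by linarith)]
    nlinarith
  · refine le_trans ?_ hq
    conv_rhs => rw [← Real.exp_log hc]
    rw [Real.exp_le_exp]
    have := neg_abs_le (Real.log c)
    nlinarith [mul_le_mul_of_nonneg_right h h0, mul_nonneg hM.le ht]

/-- Membership in a ray of slope `± κ` emanating from a point of `[0, 1/2]`. -/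
def OnRay (κ : ℝ) (w : ℂ) : Prop :=
  ∃ α ∈ Icc (0 : ℝ) (1 / 2), α ≤ w.re ∧ |w.im| = κ * (w.re - α)

variable {κ b : ℝ} {w : ℂ}

lemma OnRay.re_nonneg (h : OnRay κ w) : 0 ≤ w.re := by
  obtain ⟨α, h1, h2, _⟩ := h
  exact h1.1.trans h2

lemma OnRay.norm_le (hκ : 0 < κ) (h : OnRay κ w) : ‖w‖ ≤ (1 + κ) * w.re := by
  have h0 := h.re_nonneg
  obtain ⟨α, h1, h2, h3⟩ := h
  refine (Complex.norm_le_abs_re_add_abs_im w).trans ?_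
  rw [h3, abs_of_nonneg h0]
  nlinarith [mul_nonneg hκ.le h1.1]

lemma exists_le_norm_exp_sub_exp (hκ : 0 < κ) (hb : 0 < b) (hbκ : 2 * b * κ ≤ 1) :
    ∃ c : ℝ, 0 < c ∧ ∀ w, OnRay κ w → c ≤ ‖Complex.exp (-(b * w)) - Real.exp (-b)‖ := by
  have hn : ∀ w : ℂ, ‖Complex.exp (-(b * w))‖ = Real.exp (-(b * w.re)) := by
    intro w; rw [Complex.norm_exp]; simp
  have hr : ‖((Real.exp (-b) : ℝ) : ℂ)‖ = Real.exp (-b) := by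
    rw [Complex.norm_real, Real.norm_of_nonneg (Real.exp_pos _).le]
  set c₁ := Real.exp (-(b * (3 / 4))) - Real.exp (-b)
  set c₂ := Real.exp (-b) - Real.exp (-(b * 2))
  set c₃ := Real.exp (-(b * 2)) * Real.sin (b * κ / 4)
  have hc₁ : 0 < c₁ := sub_pos.2 (Real.exp_lt_exp.2 (by linarith))
  have hc₂ : 0 < c₂ := sub_pos.2 (Real.exp_lt_exp.2 (by linarith))
  have hbκ0 : 0 < b * κ := by positivity
  have hc₃ : 0 < c₃ := mul_pos (Real.exp_pos _)
    (Real.sin_pos_of_pos_of_lt_pi (by positivity) (by nlinarith [Real.pi_gt_three]))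
  refine ⟨min c₁ (min c₂ c₃), by positivity, fun w hw => ?_⟩
  obtain ⟨α, ⟨h0, h1⟩, h2, h3⟩ := hw
  rcases le_total w.re (3 / 4) with h | h
  · refine (min_le_left _ _).trans ((norm_sub_norm_le _ _).trans' ?_)
    rw [hn, hr]
    refine sub_le_sub_right (Real.exp_le_exp.2 ?_) _
    nlinarith
  rcases le_total 2 w.re with h' | h'
  · refine ((min_le_right _ _).trans (min_le_left _ _)).trans ?_
    rw [norm_sub_rev]
    refine (norm_sub_norm_le _ _).trans' ?_
    rw [hn, hr]
    refine sub_le_sub_left (Real.exp_le_exp.2 ?_) _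
    nlinarith
  · refine ((min_le_right _ _).trans (min_le_right _ _)).trans ?_
    refine (Complex.abs_im_le_norm _).trans' ?_
    have him : (Complex.exp (-(b * w)) - (Real.exp (-b) : ℝ)).im =
        Real.exp (-(b * w.re)) * Real.sin (-(b * w.im)) := by
      rw [Complex.sub_im, Complex.ofReal_im, sub_zero, Complex.exp_im]
      simp
    have hlow : b * κ / 4 ≤ b * |w.im| := by
      rw [h3]
      nlinarith [mul_le_mul_of_nonneg_left (show 1 / 4 ≤ w.re - α by linarith) hbκ0.le]
    have hup : b * |w.im| ≤ 1 := by
      rw [h3]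
      nlinarith [mul_le_mul_of_nonneg_left (show w.re - α ≤ 2 by linarith) hbκ0.le]
    have hsin : |Real.sin (-(b * w.im))| = Real.sin (b * |w.im|) := by
      have habs : |b * w.im| = b * |w.im| := by rw [abs_mul, abs_of_pos hb]
      rw [Real.sin_neg, abs_neg, Real.abs_sin_eq_sin_abs_of_abs_le_pi, habs]
      rw [habs]
      linarith [Real.pi_gt_three]
    rw [him, abs_mul, abs_of_pos (Real.exp_pos _), hsin]
    refine mul_le_mul (Real.exp_le_exp.2 (by nlinarith)) ?_ ?_ (Real.exp_pos _).le
    · exact Real.sin_le_sin_of_le_of_le_pi_div_two (by linarith [Real.pi_pos])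
        (by linarith [Real.pi_gt_three]) hlow
    · exact (Real.sin_pos_of_pos_of_lt_pi (by positivity) (by nlinarith [Real.pi_gt_three])).le

lemma one_sub_two_mul_norm_le {w : ℂ} (hb : 0 < b) :
    1 - 2 * b * ‖w‖ ≤ 1 - ‖1 - Complex.exp (-(b * w))‖ ∨ 1 - 2 * b * ‖w‖ ≤ 0 := by
  have hX : ‖-((b : ℂ) * w)‖ = b * ‖w‖ := by
    rw [norm_neg, norm_mul, Complex.norm_real, Real.norm_of_nonneg hb.le]
  rcases le_total (b * ‖w‖) 1 with h | h
  · left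
    have := Complex.norm_exp_sub_one_le (x := -((b : ℂ) * w)) (by rw [hX]; exact h)
    rw [hX, norm_sub_rev] at this
    linarith
  · right
    linarith

lemma exists_exp_le_norm_zeroFactor (hκ : 0 < κ) (hb : 0 < b) (hbκ : 2 * b * κ ≤ 1) :
    ∃ C c : ℝ, 0 < C ∧ 0 < c ∧ ∀ w, OnRay κ w →
      c ≤ ‖blockFactor b 0 w‖ ∧ Real.exp (-(C * ‖w‖)) ≤ ‖blockFactor b 0 w‖ := by
  obtain ⟨c, hc, hcw⟩ := exists_le_norm_exp_sub_exp hκ hb hbκ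
  have hx1 : Real.exp (-b) < 1 := by simpa using hb
  have hx : 0 < 1 - Real.exp (-b) := by linarith
  obtain ⟨C, hC, hCq⟩ := exists_exp_neg_mul_le (c := c / (1 - Real.exp (-b)))
    (M := 2 * b / (1 - Real.exp (-b))) (by positivity) (by positivity)
  refine ⟨C, c / (1 - Real.exp (-b)), hC, by positivity, fun w hw => ?_⟩
  have hval : ‖blockFactor b 0 w‖ =
      ‖Complex.exp (-(b * w)) - Real.exp (-b)‖ / (1 - Real.exp (-b)) := by
    rw [blockFactor, pow_zero, mul_one, norm_div, Complex.norm_real, Real.norm_of_nonneg hx.le]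
  have h1 : c / (1 - Real.exp (-b)) ≤ ‖blockFactor b 0 w‖ := by
    rw [hval]
    gcongr
    exact hcw w hw
  refine ⟨h1, hCq _ _ (norm_nonneg _) h1 ?_⟩
  rcases one_sub_two_mul_norm_le (w := w) hb with h | h
  · rw [hval, le_div_iff₀ hx, sub_mul, div_mul_eq_mul_div, div_mul_cancel₀ _ hx.ne', one_mul]
    have e : (1 : ℂ) - Real.exp (-b) =
        (1 - Complex.exp (-(b * w))) + (Complex.exp (-(b * w)) - Real.exp (-b)) := by ring
    have h2 : 1 - Real.exp (-b) = ‖(1 : ℂ) - Real.exp (-b)‖ := by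
      rw [← Complex.ofReal_one, ← Complex.ofReal_sub, Complex.norm_real, Real.norm_of_nonneg hx.le]
    have h3 := norm_add_le (1 - Complex.exp (-(b * w))) (Complex.exp (-(b * w)) - Real.exp (-b))
    rw [← e, ← h2] at h3
    linarith
  · refine le_trans ?_ (norm_nonneg _)
    have : 2 * b * ‖w‖ ≤ 2 * b / (1 - Real.exp (-b)) * ‖w‖ := by
      gcongr
      rw [le_div_iff₀ hx]
      nlinarith [Real.exp_pos (-b)]
    linarith

lemma exists_exp_le_norm_average (hκ : 0 < κ) (hb : 0 < b) :
    ∃ C : ℝ, 0 < C ∧ ∀ w, OnRay κ w →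
      Real.exp (-(C * ‖w‖)) ≤ ‖(1 + Complex.exp (-(b * w))) / 2‖ := by
  set η : ℝ := 1 / (4 * b * (1 + κ)) with hη
  have hη0 : 0 < η := by positivity
  have hxη : Real.exp (-(b * η)) < 1 := by simp; positivity
  set c : ℝ := min (1 / 2) ((1 - Real.exp (-(b * η))) / 2) with hc
  have hc0 : 0 < c := lt_min (by norm_num) (by linarith)
  obtain ⟨C, hC, hCq⟩ := exists_exp_neg_mul_le (c := c) (M := 2 * b) hc0 (by positivity)
  refine ⟨C, hC, fun w hw => ?_⟩
  have h1 : 1 - 2 * b * ‖w‖ ≤ ‖(1 + Complex.exp (-(b * w))) / 2‖ := by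
    rcases one_sub_two_mul_norm_le (w := w) hb with h | h
    · have e : (1 : ℂ) = (1 + Complex.exp (-(b * w))) / 2 + (1 - Complex.exp (-(b * w))) / 2 := by
        ring
      have h3 := norm_add_le ((1 + Complex.exp (-(b * w))) / 2) ((1 - Complex.exp (-(b * w))) / 2)
      rw [← e, norm_one, norm_div (1 - _)] at h3
      simp only [Complex.norm_ofNat] at h3
      linarith [norm_nonneg (1 - Complex.exp (-(b * w)))]
    · exact h.trans (norm_nonneg _)
  refine hCq _ _ (norm_nonneg _) ?_ h1
  rcases le_total η w.re with h | h
  · refine (min_le_right _ _).trans ?_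
    have h3 := norm_sub_norm_le (1 : ℂ) (-Complex.exp (-(b * w)))
    rw [norm_div, Complex.norm_ofNat]
    rw [norm_one, norm_neg, sub_neg_eq_add, Complex.norm_exp] at h3
    gcongr
    refine le_trans (sub_le_sub_left (Real.exp_le_exp.2 ?_) _) h3
    simp
    gcongr
  · refine (min_le_left _ _).trans (le_trans ?_ h1)
    have h4 : ‖w‖ ≤ (1 + κ) * η := (hw.norm_le hκ).trans (by gcongr)
    have h5 : 2 * b * ((1 + κ) * η) = 1 / 2 := by
      rw [hη]; field_simp; norm_num
    nlinarith

lemma exists_exp_le_norm_blockFactor (hκ : 0 < κ) (hb : 0 < b) (hbκ : 2 * b * κ ≤ 1) (m : ℕ) :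
    ∃ C : ℝ, 0 < C ∧ ∀ w, OnRay κ w → Real.exp (-(C * ‖w‖)) ≤ ‖blockFactor b m w‖ := by
  obtain ⟨C₁, c, hC₁, -, h₁⟩ := exists_exp_le_norm_zeroFactor hκ hb hbκ
  obtain ⟨C₂, hC₂, h₂⟩ := exists_exp_le_norm_average hκ hb
  refine ⟨C₁ + m * C₂, by positivity, fun w hw => ?_⟩
  have e : blockFactor b m w = blockFactor b 0 w * ((1 + Complex.exp (-(b * w))) / 2) ^ m := by
    simp [blockFactor]
  rw [e, norm_mul, norm_pow]
  calc Real.exp (-((C₁ + m * C₂) * ‖w‖)) =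
        Real.exp (-(C₁ * ‖w‖)) * Real.exp (-(C₂ * ‖w‖)) ^ m := by
          rw [← Real.exp_nat_mul, ← Real.exp_add]; ring_nf
    _ ≤ _ := by
          gcongr
          · exact (h₁ w hw).2
          · exact h₂ w hw

end LowerBound

section Main

lemma OnRay.ne_one {κ : ℝ} {w : ℂ} (hκ : 0 < κ) (h : OnRay κ w) : w ≠ 1 := by
  rintro rfl
  obtain ⟨α, ⟨_, h1⟩, _, h3⟩ := h
  simp only [Complex.one_im, abs_zero, Complex.one_re] at h3
  nlinarith

lemma exists_sum_Ico_le {u : ℕ → ℝ} (hu : Summable u) {s : ℝ} (hs : 0 < s) :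
    ∃ J, ∀ N, ∑ j ∈ Finset.Ico J N, u j ≤ s := by
  obtain ⟨F, hF⟩ := summable_iff_vanishing_norm.1 hu s hs
  obtain ⟨J, hJ⟩ := F.exists_nat_subset_range
  refine ⟨J, fun N => (le_abs_self _).trans (hF _ ?_).le⟩
  refine Finset.disjoint_left.2 fun j hj hjF => ?_
  have := Finset.mem_range.1 (hJ hjF)
  have := (Finset.mem_Ico.1 hj).1
  omega

/-- Multipliers of arbitrarily short length vanishing at the first `N` frequencies, bounded below
on rays uniformly in `N`. -/
lemma exists_multiplier {Λ : ℕ → ℝ} (hpos : ∀ j, 0 < Λ j) (hsum : Summable fun j => 1 / Λ j)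
    {κ T η : ℝ} (hκ : 0 < κ) (hT : 0 < T) (hη : 0 < η) :
    ∃ K c : ℝ, 0 < K ∧ 0 < c ∧ ∀ N : ℕ, ∃ (L : ℝ) (H : ℂ → ℂ), IsMultiplier L K H ∧ L ≤ T ∧
      (∀ j < N, H (Λ j) = 0) ∧
      ∀ ζ : ℂ, (∀ j, OnRay κ (ζ / Λ j)) → c * Real.exp (-(η * ‖ζ‖)) ≤ ‖H ζ‖ := by
  set b : ℝ := 1 / (2 * κ) with hb
  have hb0 : 0 < b := by positivity
  have hbκ : 2 * b * κ = 1 := by rw [hb]; field_simp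
  have hx : 0 < 1 - Real.exp (-b) := by
    have : Real.exp (-b) < 1 := by simpa using hb0
    linarith
  obtain ⟨m, hm⟩ := exists_nat_ge (4 * Real.exp (-b) / (1 - Real.exp (-b)) ^ 2)
  rw [div_le_iff₀ (by positivity)] at hm
  obtain ⟨C, hC, hCw⟩ := exists_exp_le_norm_blockFactor hκ hb0 hbκ.le m
  obtain ⟨J, hJ⟩ := exists_sum_Ico_le hsum
    (s := min (η / C) (T / 2 / ((m + 1) * b))) (by positivity)
  have hS0 : 0 ≤ ∑' j, 1 / Λ j := tsum_nonneg fun j => (one_div_pos.2 (hpos j)).le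
  set β : ℝ := min b (T / 2 / (∑' j, 1 / Λ j + 1)) with hβ
  have hβ0 : 0 < β := by positivity
  have hβκ : 2 * β * κ ≤ 1 := by
    rw [← hbκ]
    gcongr
    exact min_le_left _ _
  have hxβ : 0 < 1 - Real.exp (-β) := by
    have : Real.exp (-β) < 1 := by simpa using hβ0
    linarith
  obtain ⟨_, c, -, hc, hcw⟩ := exists_exp_le_norm_zeroFactor hκ hβ0 hβκ
  refine ⟨(2 / (1 - Real.exp (-β))) ^ J, c ^ J, by positivity, by positivity, fun N => ?_⟩
  have h1 := IsMultiplier.prod (Finset.range J)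
    (fun j => isMultiplier_blockFactor_zero hβ0 (hpos j)) (fun _ => by positivity)
  have h2 := IsMultiplier.prod (Finset.Ico J N)
    (fun j => isMultiplier_blockFactor hb0 (hpos j) hm) (fun _ => zero_le_one)
  have h3 := h1.mul h2 (by simp)
  simp only [Finset.prod_const, one_pow, mul_one, Finset.card_range] at h3
  have hone : ∀ j, ((Λ j : ℝ) : ℂ) / Λ j = 1 := fun j =>
    div_self (Complex.ofReal_ne_zero.2 (hpos j).ne')
  refine ⟨_, _, h3, ?_, ?_, ?_⟩
  · have e1 : ∑ j ∈ Finset.range J, β / Λ j ≤ T / 2 := by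
      calc ∑ j ∈ Finset.range J, β / Λ j = β * ∑ j ∈ Finset.range J, 1 / Λ j := by
            rw [Finset.mul_sum]; simp only [mul_one_div]
        _ ≤ T / 2 / (∑' j, 1 / Λ j + 1) * (∑' j, 1 / Λ j + 1) := by
            have := hsum.sum_le_tsum (Finset.range J)
              (fun j _ => (one_div_pos.2 (hpos j)).le)
            exact mul_le_mul (min_le_right _ _) (by linarith)
              (Finset.sum_nonneg fun j _ => (one_div_pos.2 (hpos j)).le) (by positivity)
        _ = T / 2 := by field_simp
    have e2 : ∑ j ∈ Finset.Ico J N, ((m : ℝ) + 1) * (b / Λ j) ≤ T / 2 := by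
      calc ∑ j ∈ Finset.Ico J N, ((m : ℝ) + 1) * (b / Λ j) =
            ((m + 1) * b) * ∑ j ∈ Finset.Ico J N, 1 / Λ j := by
            rw [Finset.mul_sum]
            exact Finset.sum_congr rfl fun j _ => by ring
        _ ≤ ((m + 1) * b) * (T / 2 / ((m + 1) * b)) := by
            gcongr
            exact (hJ N).trans (min_le_right _ _)
        _ = T / 2 := by field_simp
    linarith
  · intro j hj
    rcases lt_or_ge j J with h | h
    · refine mul_eq_zero_of_left (Finset.prod_eq_zero (Finset.mem_range.2 h) ?_) _
      rw [hone, blockFactor_one]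
    · refine mul_eq_zero_of_right _ (Finset.prod_eq_zero (Finset.mem_Ico.2 ⟨h, hj⟩) ?_)
      rw [hone, blockFactor_one]
  · intro ζ hζ
    rw [norm_mul, norm_prod, norm_prod]
    refine mul_le_mul ?_ ?_ (Real.exp_pos _).le (Finset.prod_nonneg fun _ _ => norm_nonneg _)
    · rw [← Finset.card_range J, ← Finset.prod_const, Finset.card_range]
      exact Finset.prod_le_prod (fun _ _ => hc.le) fun j _ => (hcw _ (hζ j)).1
    · calc Real.exp (-(η * ‖ζ‖)) ≤
            Real.exp (∑ j ∈ Finset.Ico J N, -(C * ‖ζ / Λ j‖)) := by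
            have e : ∑ j ∈ Finset.Ico J N, -(C * ‖ζ / Λ j‖) =
                -(C * (∑ j ∈ Finset.Ico J N, 1 / Λ j) * ‖ζ‖) := by
              rw [Finset.sum_neg_distrib, Finset.mul_sum, Finset.sum_mul]
              congr 1
              refine Finset.sum_congr rfl fun j _ => ?_
              rw [norm_div, Complex.norm_real, Real.norm_of_nonneg (hpos j).le]
              ring
            rw [e]
            gcongr
            calc C * ∑ j ∈ Finset.Ico J N, 1 / Λ j ≤ C * (η / C) := by
                  gcongr
                  exact (hJ N).trans (min_le_left _ _)
              _ = η := by field_simp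
        _ = ∏ j ∈ Finset.Ico J N, Real.exp (-(C * ‖ζ / Λ j‖)) := Real.exp_sum _ _
        _ ≤ _ := Finset.prod_le_prod (fun _ _ => (Real.exp_pos _).le) fun j _ => hCw _ (hζ j)

lemma onRay_div {v a b t l : ℝ} {ω : ℂ} (hv : 0 ≤ v) (hl : 0 < l) (hvl : 2 * v ≤ l) (ha : 0 < a)
    (hre : ω.re = a) (him : |ω.im| = b) (ht : 0 ≤ t) :
    OnRay (b / a) ((v + t * ω) / l) := by
  have e1 : ((v + t * ω) / l : ℂ).re = (v + t * a) / l := by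
    rw [Complex.div_ofReal_re]; simp [hre]
  have e2 : ((v + t * ω) / l : ℂ).im = t * ω.im / l := by
    rw [Complex.div_ofReal_im]; simp
  refine ⟨v / l, ⟨by positivity, ?_⟩, ?_, ?_⟩
  · rw [div_le_iff₀ hl]; linarith
  · rw [e1]
    gcongr
    nlinarith
  · rw [e1, e2, abs_div, abs_mul, him, abs_of_nonneg ht, abs_of_pos hl]
    field_simp
    ring

/-- Uniform bound for resolvent sums on the boundary of a sector. -/
lemma exists_resolvent_bound {Λ : ℕ → ℝ} (hpos : ∀ j, 0 < Λ j)
    (hsum : Summable fun j => 1 / Λ j) {v a b δ T : ℝ} (hv : 0 < v) (hvΛ : ∀ j, 2 * v ≤ Λ j)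
    (ha : 0 < a) (hb : 0 < b) (hab : a ^ 2 + b ^ 2 = 1) (hδ : 0 < δ) (hT : 0 < T) :
    ∃ M : ℝ, 0 < M ∧ ∀ (N : ℕ) (c : Fin N → ℂ) (ω : ℂ), ω.re = a → |ω.im| = b →
      ∀ t : ℝ, 0 ≤ t → ‖∑ j, c j / (v + t * ω - Λ j)‖ ≤
        M * (∫ u in Ioc (0 : ℝ) T, ‖∑ j : Fin N, c j * Complex.exp (-(Λ j : ℂ) * u)‖) *
          Real.exp (δ * t) := by
  have hκ : 0 < b / a := by positivity
  obtain ⟨K, c₀, hK, hc₀, hH⟩ := exists_multiplier hpos hsum hκ (half_pos hT) (half_pos hδ)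
  set τ : ℝ := min (δ / 2) (T / 2) with hτ
  have hτ0 : 0 < τ := by positivity
  refine ⟨K * √T / (c₀ * √τ) * Real.exp (δ * v), by positivity, fun N c ω hre him t ht => ?_⟩
  set P := ∫ u in Ioc (0 : ℝ) T, ‖∑ j : Fin N, c j * Complex.exp (-(Λ j : ℂ) * u)‖ with hP
  have hP0 : 0 ≤ P := integral_nonneg fun _ => norm_nonneg _
  obtain ⟨L, H, hHm, hL, hHz, hHl⟩ := hH N
  set ζ : ℂ := v + t * ω with hζ
  have hray : ∀ j, OnRay (b / a) (ζ / Λ j) := fun j =>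
    onRay_div hv.le (hpos j) (hvΛ j) ha hre him ht
  have hζne : ∀ j : Fin N, ζ ≠ (Λ j : ℝ) := by
    intro j h
    refine (hray j).ne_one hκ ?_
    rw [h, div_self (Complex.ofReal_ne_zero.2 (hpos j).ne')]
  have hζre : ζ.re = v + t * a := by simp [hζ, hre]
  have hζre0 : 0 ≤ ζ.re := by rw [hζre]; positivity
  have hωn : ‖ω‖ = 1 := by
    rw [Complex.norm_def, Complex.normSq_apply, hre, ← abs_mul_abs_self ω.im, him,
      show a * a + b * b = 1 by nlinarith, Real.sqrt_one]
  have hζn : ‖ζ‖ ≤ v + t := by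
    refine (norm_add_le _ _).trans ?_
    rw [norm_mul, hωn, Complex.norm_real, Complex.norm_real, Real.norm_of_nonneg hv.le,
      Real.norm_of_nonneg ht, mul_one]
  have hmain := hHm.norm_resolvent_le (c := c) (l := fun j : Fin N => Λ j) (T := T) (ζ := ζ)
    (τ := τ) hK.le hT.le (by linarith [min_le_right (δ / 2) (T / 2)])
    (fun j => hHz j j.2) hζre0 hζne
  have hlow : c₀ * √τ * Real.exp (-(δ * (v + t))) ≤
      ‖H ζ‖ * Real.exp (-(τ * ζ.re)) * √τ := by
    have e1 : c₀ * Real.exp (-(δ / 2 * (v + t))) ≤ ‖H ζ‖ := by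
      refine le_trans ?_ (hHl ζ hray)
      gcongr
    have e2 : Real.exp (-(δ / 2 * (v + t))) ≤ Real.exp (-(τ * ζ.re)) := by
      gcongr
      · exact min_le_left _ _
      · exact (Complex.re_le_norm _).trans hζn
    calc c₀ * √τ * Real.exp (-(δ * (v + t))) =
          c₀ * Real.exp (-(δ / 2 * (v + t))) * Real.exp (-(δ / 2 * (v + t))) * √τ := by
          rw [show -(δ * (v + t)) = -(δ / 2 * (v + t)) + -(δ / 2 * (v + t)) by ring, Real.exp_add]
          ring
      _ ≤ _ := by gcongr
  have hfin : ‖∑ j, c j / (ζ - Λ j)‖ * (c₀ * √τ * Real.exp (-(δ * (v + t)))) ≤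
      K * (P * √T) := by
    refine le_trans (mul_le_mul_of_nonneg_left hlow (norm_nonneg _)) ?_
    rw [← mul_assoc, ← mul_assoc]
    exact hmain
  rw [← le_div_iff₀ (by positivity)] at hfin
  refine hfin.trans (le_of_eq ?_)
  rw [Real.exp_neg, show δ * (v + t) = δ * v + δ * t by ring, Real.exp_add]
  field_simp

end Main

/-- Fix `θ₀ ∈ (0,π/2)`, `ε > 0` and `T ∈ (0,∞)`.  There are constants
`C₂ > 0`, depending only on `θ₀` and `Λ`, and `C₁ > 0`, depending only on `θ₀`, `ε`, `T`
and `Λ`, such that for every Dirichlet polynomial `p` (with exponents in `Λ`) and every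
`z ∈ S_{ε,θ₀}`:  `|p(z)| ≤ C₁ e^{−C₂·Re z} ∫₀ᵀ |p(t)| dt`. -/
theorem statement19 (Λ : ℕ → ℝ) (hpos : ∀ j, 0 < Λ j) (hmono : StrictMono Λ)
    (hsum : Summable fun j => 1 / Λ j)
    (θ₀ : ℝ) (hθ₀ : θ₀ ∈ Ioo (0 : ℝ) (Real.pi / 2)) :
    ∃ C₂ : ℝ, 0 < C₂ ∧ ∀ ε : ℝ, 0 < ε → ∀ T : ℝ, 0 < T →
      ∃ C₁ : ℝ, 0 < C₁ ∧ ∀ p : ℂ → ℂ, IsDirichletPoly Λ p → ∀ z : ℂ, InSector ε θ₀ z →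
        ‖p z‖ ≤ C₁ * Real.exp (-C₂ * z.re) * ∫ t in Ioc (0 : ℝ) T, ‖p (t : ℂ)‖ := by
  have hθpi : θ₀ < Real.pi := by linarith [hθ₀.2, Real.pi_pos]
  have hb : 0 < Real.sin θ₀ := Real.sin_pos_of_pos_of_lt_pi hθ₀.1 hθpi
  have ha : 0 < Real.cos θ₀ :=
    Real.cos_pos_of_mem_Ioo ⟨by linarith [hθ₀.1, Real.pi_pos], hθ₀.2⟩
  have hv : 0 < Λ 0 / 2 := half_pos (hpos 0)
  have hvΛ : ∀ j, 2 * (Λ 0 / 2) ≤ Λ j := fun j => by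
    linarith [hmono.monotone (Nat.zero_le j)]
  refine ⟨Λ 0 / 2, hv, fun ε hε T hT => ?_⟩
  obtain ⟨M, hM, hbound⟩ := exists_resolvent_bound hpos hsum hv hvΛ ha hb
    (Real.cos_sq_add_sin_sq θ₀) (δ := ε * Real.cos θ₀ / 4) (by positivity) hT
  refine ⟨M / (ε * Real.cos θ₀ / 4), by positivity, ?_⟩
  rintro p ⟨N, c, rfl⟩ z ⟨hz1, hz2⟩
  have hz : |z.im| * Real.sin θ₀ ≤ z.re * Real.cos θ₀ / 2 := by
    rw [mul_div_assoc', le_div_iff₀ hb] at hz2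
    linarith
  refine (norm_expSum_le_of_resolvent_bound (c := c) (l := fun j : Fin N => Λ j) (v := Λ 0 / 2)
    (fun j => by linarith [hvΛ j, hpos j]) hε
    (by positivity) le_rfl ha hb (Real.cos_sq_add_sin_sq θ₀) hz1 hz (hbound N c)).trans
    (le_of_eq (by ring))

end DirichletBBP
end
end
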